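/- (Khintchin–Ostrowski theorem.) Let {f_n} be a sequence of analytic functions on the open unit disc D satisfying: (i) there is a constant C > 0 such that ∫_𝕋 log⁺ |f_n(r e^{it})| dt ≤ C for all n and all 0 < r < 1; (ii) each f_n has radial boundary values f_n*(ζ) = lim_{r→1⁻} f_n(rζ) for a.e. ζ ∈ 𝕋, and on some measurable set E ⊂ 𝕋 of positive measure the boundary functions f_n* converge in measure to a function φ. Then f_n converges uniformly on compact subsets of D to an analytic function f, f has radial boundary values f* a.e. on 𝕋, and f* = φ a.e. on E. -/

import Mathlib

open MeasureTheory Complex Metric Filter Set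
open scoped Real ENNReal Topology

noncomputable section

instance fact_two_pi : Fact (0 < 2 * Real.pi) := ⟨by positivity⟩

abbrev CircT := AddCircle (2 * Real.pi)
abbrev m : Measure CircT := AddCircle.haarAddCircle

/-- The point `e^{iθ}` of the unit circle in `ℂ` corresponding to `θ`. -/
def pt (θ : CircT) : ℂ := (AddCircle.toCircle θ : ℂ)

lemma pt_norm (θ : CircT) : ‖pt θ‖ = 1 := Circle.norm_coe _

lemma pt_cont : Continuous pt := by
  unfold pt
  exact continuous_subtype_val.comp AddCircle.continuous_toCircle

lemma pt_ne (θ : CircT) : pt θ ≠ 0 := by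
  intro h; have := pt_norm θ; simp [h] at this

lemma pt_coe (t : ℝ) : pt (t : CircT) = exp (t * I) := by
  simp [pt, AddCircle.toCircle, Circle.coe_exp]

lemma pt_add (a b : CircT) : pt (a + b) = pt a * pt b := by
  simp [pt, AddCircle.toCircle_add]

lemma fourier_eq_pt (n : ℤ) (θ : CircT) : fourier n θ = pt θ ^ n := by
  simp [pt, fourier_apply, AddCircle.toCircle_zsmul]

lemma int_pt {E : Type*} [NormedAddCommGroup E] [NormedSpace ℝ E] (g : ℂ → E) :
    ∫ θ, g (pt θ) ∂m = Real.circleAverage g 0 1 := by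
  rw [AddCircle.integral_haarAddCircle, Real.circleAverage,
    ← AddCircle.intervalIntegral_preimage (2 * π) 0]
  simp [pt_coe, circleMap]

lemma integrable_cont {E : Type*} [NormedAddCommGroup E] {g : CircT → E} (hg : Continuous g) :
    Integrable g m :=
  hg.integrable_of_hasCompactSupport (HasCompactSupport.of_compactSpace g)

lemma pk_cont {z : ℂ} (hz : ‖z‖ < 1) : Continuous fun θ => poissonKernel 0 z (pt θ) := by
  unfold poissonKernel
  refine Continuous.div (by have := pt_cont; fun_prop) (by have := pt_cont; fun_prop) fun θ h => ?_
  have h1 : pt θ = z := by simpa [sub_eq_zero] using h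
  rw [← h1, pt_norm] at hz
  exact lt_irrefl _ hz

lemma pk_le {z : ℂ} (hz : ‖z‖ < 1) (θ : CircT) :
    poissonKernel 0 z (pt θ) ≤ (1 + ‖z‖) / (1 - ‖z‖) := by
  rw [poissonKernel_eq_re_herglotzRieszKernel]
  simpa [herglotzRieszKernel] using re_herglotzRieszKernel_le (c := 0) (R := 1) (z := pt θ) (w := z)
    (by simp [pt_norm]) (by simpa using hz)

lemma le_pk {z : ℂ} (hz : ‖z‖ < 1) (θ : CircT) :
    (1 - ‖z‖) / (1 + ‖z‖) ≤ poissonKernel 0 z (pt θ) := by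
  rw [poissonKernel_eq_re_herglotzRieszKernel]
  simpa [herglotzRieszKernel] using le_re_herglotzRieszKernel (c := 0) (R := 1) (z := pt θ) (w := z)
    (by simp [pt_norm]) (by simpa using hz)

lemma pk_nonneg {z : ℂ} (hz : ‖z‖ < 1) (θ : CircT) : 0 ≤ poissonKernel 0 z (pt θ) :=
  le_trans (div_nonneg (by linarith) (by positivity)) (le_pk hz θ)

lemma poisson {p : ℂ → ℂ} (hp : DiffContOnCl ℂ p (ball 0 1)) {z : ℂ} (hz : ‖z‖ < 1) :
    ∫ θ, poissonKernel 0 z (pt θ) • p (pt θ) ∂m = p z := by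
  rw [int_pt (fun w => poissonKernel 0 z w • p w)]
  exact hp.circleAverage_poissonKernel_smul (by simpa using hz)

lemma poisson_re {p : ℂ → ℂ} (hp : Differentiable ℂ p) {z : ℂ} (hz : ‖z‖ < 1) :
    ∫ θ, poissonKernel 0 z (pt θ) * (p (pt θ)).re ∂m = (p z).re := by
  rw [← poisson hp.diffContOnCl hz]
  have := integral_re (f := fun θ => poissonKernel 0 z (pt θ) • p (pt θ)) (μ := m) (𝕜 := ℂ)
    (integrable_cont ((pk_cont hz).smul (hp.continuous.comp pt_cont)))
  simpa using this

lemma poisson_one {z : ℂ} (hz : ‖z‖ < 1) :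
    ∫ θ, poissonKernel 0 z (pt θ) ∂m = 1 := by
  simpa using poisson_re (p := fun _ => 1) (by fun_prop) hz

lemma cont_circ {g : ℂ → ℂ} (hg : DiffContOnCl ℂ g (ball 0 1)) : Continuous fun θ => g (pt θ) := by
  refine hg.continuousOn.comp_continuous pt_cont fun θ => ?_
  rw [closure_ball _ one_ne_zero]; simp [pt_norm]

lemma mem_sphere_pt {w : ℂ} (hw : ‖w‖ = 1) : ∃ θ, pt θ = w := by
  refine ⟨((arg w : ℝ) : CircT), ?_⟩
  rw [pt_coe]
  have := norm_mul_exp_arg_mul_I w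
  rwa [hw, ofReal_one, one_mul] at this

/-- majorant principle -/
lemma majorant {g p : ℂ → ℂ} (hg : DiffContOnCl ℂ g (ball 0 1)) (hp : Differentiable ℂ p)
    (h : ∀ θ, ‖g (pt θ)‖ ≤ Real.exp (p (pt θ)).re) {z : ℂ} (hz : ‖z‖ ≤ 1) :
    ‖g z‖ ≤ Real.exp (p z).re := by
  have h1 : DiffContOnCl ℂ (fun z => exp (-p z) • g z) (ball 0 1) :=
    (Differentiable.diffContOnCl (by fun_prop)).smul hg
  have h2 := Complex.norm_le_of_forall_mem_frontier_norm_le (C := 1) isBounded_ball h1 (z := z) ?_ ?_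
  · rw [norm_smul, norm_exp] at h2
    simp only [neg_re, Real.exp_neg] at h2
    rwa [inv_mul_le_iff₀ (Real.exp_pos _), mul_one] at h2
  · intro w hw
    rw [frontier_ball _ one_ne_zero] at hw
    obtain ⟨θ, rfl⟩ := mem_sphere_pt (by simpa using hw)
    rw [norm_smul, norm_exp]
    simp only [neg_re, Real.exp_neg]
    rw [inv_mul_le_iff₀ (Real.exp_pos _), mul_one]
    exact h θ
  · rw [closure_ball _ one_ne_zero]; simpa using hz

lemma approx (h : C(CircT, ℝ)) {η : ℝ} (hη : 0 < η) :
    ∃ p : ℂ → ℂ, Differentiable ℂ p ∧ ∀ θ, |h θ - (p (pt θ)).re| < η := by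
  let H : C(CircT, ℂ) := ⟨fun θ => (h θ : ℂ), by fun_prop⟩
  have hH : H ∈ (Submodule.span ℂ (range (@fourier (2 * π)))).topologicalClosure := by
    rw [span_fourier_closure_eq_top]; trivial
  have hH' : H ∈ closure (Submodule.span ℂ (range (@fourier (2 * π))) : Set C(CircT, ℂ)) := hH
  obtain ⟨s, hs, hd⟩ := Metric.mem_closure_iff.1 hH' η hη
  have key : ∀ s ∈ Submodule.span ℂ (range (@fourier (2 * π))), ∃ p q : ℂ → ℂ, Differentiable ℂ p ∧
      Differentiable ℂ q ∧ ∀ θ, s θ = p (pt θ) + (starRingEnd ℂ) (q (pt θ)) := by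
    intro s hs
    induction hs using Submodule.span_induction with
    | mem x hx =>
      obtain ⟨n, rfl⟩ := hx
      rcases Int.eq_nat_or_neg n with ⟨k, rfl | rfl⟩
      · refine ⟨fun z => z ^ k, fun _ => 0, by fun_prop, by fun_prop, fun θ => ?_⟩
        simp [fourier_eq_pt, -fourier_apply]
      · refine ⟨fun _ => 0, fun z => z ^ k, by fun_prop, by fun_prop, fun θ => ?_⟩
        rw [fourier_neg, fourier_eq_pt]; simp
    | zero => exact ⟨fun _ => 0, fun _ => 0, by fun_prop, by fun_prop, by simp⟩
    | add x y _ _ hx hy =>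
      obtain ⟨p, q, hp, hq, h⟩ := hx
      obtain ⟨p', q', hp', hq', h'⟩ := hy
      refine ⟨fun z => p z + p' z, fun z => q z + q' z, by fun_prop, by fun_prop, fun θ => ?_⟩
      simp [h, h']; ring
    | smul c x _ hx =>
      obtain ⟨p, q, hp, hq, h⟩ := hx
      refine ⟨fun z => c * p z, fun z => (starRingEnd ℂ) c * q z, by fun_prop, by fun_prop, fun θ => ?_⟩
      simp [h]; ring
  obtain ⟨p, q, hp, hq, hpq⟩ := key s hs
  refine ⟨fun z => p z + q z, by fun_prop, fun θ => ?_⟩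
  have h1 : ‖H θ - s θ‖ < η := by
    rw [← dist_eq_norm]; exact lt_of_le_of_lt (ContinuousMap.dist_apply_le_dist θ) hd
  refine lt_of_le_of_lt ?_ h1
  have h2 := Complex.abs_re_le_norm (H θ - s θ)
  have h3 : (H θ - s θ).re = h θ - (p (pt θ) + q (pt θ)).re := by
    simp [H, hpq]
  rw [h3] at h2
  exact h2

/-- subharmonicity of `log max |g| ε` -/
lemma sh {g : ℂ → ℂ} (hg : DiffContOnCl ℂ g (ball 0 1)) {z : ℂ} (hz : ‖z‖ < 1) {ε : ℝ}
    (hε : 0 < ε) :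
    ‖g z‖ ≤ Real.exp (∫ θ, poissonKernel 0 z (pt θ) * Real.log (max ‖g (pt θ)‖ ε) ∂m) := by
  have hgc := cont_circ hg
  have hpos : ∀ θ, 0 < max ‖g (pt θ)‖ ε := fun θ => lt_max_of_lt_right hε
  have hc : Continuous fun θ => Real.log (max ‖g (pt θ)‖ ε) :=
    Continuous.log (hgc.norm.max continuous_const) fun θ => (hpos θ).ne'
  have key : ∀ η > 0, ‖g z‖ ≤ Real.exp (∫ θ, poissonKernel 0 z (pt θ) * Real.log (max ‖g (pt θ)‖ ε) ∂m + 2 * η) := by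
    intro η hη
    obtain ⟨p, hp, hpa⟩ := approx ⟨fun θ => Real.log (max ‖g (pt θ)‖ ε) + η, by fun_prop⟩ hη
    simp only [ContinuousMap.coe_mk] at hpa
    have h1 := majorant hg hp (z := z) (fun θ => ?_) hz.le
    · refine h1.trans (Real.exp_le_exp.2 ?_)
      rw [← poisson_re hp hz]
      have h2 : ∫ θ, poissonKernel 0 z (pt θ) * Real.log (max ‖g (pt θ)‖ ε) ∂m + 2 * η
          = ∫ θ, poissonKernel 0 z (pt θ) * (Real.log (max ‖g (pt θ)‖ ε) + 2 * η) ∂m := by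
        simp only [mul_add]
        have i1 : Integrable (fun θ => poissonKernel 0 z (pt θ) * Real.log (max ‖g (pt θ)‖ ε)) m :=
          integrable_cont ((pk_cont hz).mul hc)
        have i2 : Integrable (fun θ => poissonKernel 0 z (pt θ) * (2 * η)) m :=
          integrable_cont ((pk_cont hz).mul continuous_const)
        rw [integral_add i1 i2, integral_mul_const, poisson_one hz, one_mul]
      rw [h2]
      refine integral_mono (integrable_cont ((pk_cont hz).mul (continuous_re.comp (hp.continuous.comp pt_cont))))
        (integrable_cont ((pk_cont hz).mul (hc.add continuous_const))) fun θ => ?_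
      refine mul_le_mul_of_nonneg_left ?_ (pk_nonneg hz θ)
      have := abs_lt.1 (hpa θ)
      linarith
    · have := abs_lt.1 (hpa θ)
      calc ‖g (pt θ)‖ ≤ max ‖g (pt θ)‖ ε := le_max_left _ _
        _ = Real.exp (Real.log (max ‖g (pt θ)‖ ε)) := (Real.exp_log (hpos θ)).symm
        _ ≤ _ := Real.exp_le_exp.2 (by linarith)
  refine ge_of_tendsto (x := 𝓝[>] (0:ℝ)) (f := fun η => Real.exp (∫ θ, poissonKernel 0 z (pt θ) * Real.log (max ‖g (pt θ)‖ ε) ∂m + 2 * η)) ?_ ?_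
  · have : Continuous fun η : ℝ => Real.exp (∫ θ, poissonKernel 0 z (pt θ) * Real.log (max ‖g (pt θ)‖ ε) ∂m + 2 * η) := by fun_prop
    have h := this.tendsto 0
    simp only [mul_zero, add_zero] at h
    exact h.mono_left nhdsWithin_le_nhds
  · filter_upwards [self_mem_nhdsWithin] with η hη using key η hη

def rk (k : ℕ) : ℝ := 1 - 1 / ((k : ℝ) + 2)

lemma rk_pos (k : ℕ) : 0 < rk k := by
  have : (1:ℝ) / ((k : ℝ) + 2) < 1 := by
    rw [div_lt_one (by positivity)]; linarith [(Nat.cast_nonneg k : (0:ℝ) ≤ k)]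
  unfold rk; linarith

lemma rk_lt (k : ℕ) : rk k < 1 := by
  have : (0:ℝ) < 1 / ((k : ℝ) + 2) := by positivity
  unfold rk; linarith

lemma rk_tendsto : Tendsto rk atTop (𝓝 1) := by
  have h : Tendsto (fun k : ℕ => 1 / ((k : ℝ) + 2)) atTop (𝓝 0) := by
    have := (tendsto_one_div_add_atTop_nhds_zero_nat (𝕜 := ℝ)).comp (tendsto_add_atTop_nat 1)
    refine this.congr fun k => ?_
    simp only [Function.comp]; push_cast; ring
  have h2 := tendsto_const_nhds (x := (1:ℝ)) (f := atTop).sub h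
  rw [sub_zero] at h2
  exact h2

lemma rk_tendsto' : Tendsto rk atTop (𝓝[<] 1) :=
  tendsto_nhdsWithin_iff.2 ⟨rk_tendsto, Eventually.of_forall rk_lt⟩

lemma mem_ball_mul {r : ℝ} (h0 : 0 < r) (h1 : r < 1) {z : ℂ} (hz : ‖z‖ ≤ 1) :
    (r : ℂ) * z ∈ ball (0:ℂ) 1 := by
  simp only [mem_ball, dist_zero_right, norm_mul, norm_real, Real.norm_eq_abs, abs_of_pos h0]
  nlinarith

lemma dil {g : ℂ → ℂ} (hg : DifferentiableOn ℂ g (ball 0 1)) {r : ℝ} (h0 : 0 < r) (h1 : r < 1) :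
    DiffContOnCl ℂ (fun z => g ((r:ℂ) * z)) (ball 0 1) := by
  refine DifferentiableOn.diffContOnCl ?_
  refine hg.comp (by fun_prop) fun z hz => ?_
  rw [closure_ball _ one_ne_zero] at hz
  exact mem_ball_mul h0 h1 (by simpa using hz)

lemma dil_cont {g : ℂ → ℂ} (hg : DifferentiableOn ℂ g (ball 0 1)) {r : ℝ} (h0 : 0 < r) (h1 : r < 1) :
    Continuous (fun θ => g ((r:ℂ) * pt θ)) := cont_circ (dil hg h0 h1)

lemma logp_cont {g : CircT → ℂ} (hg : Continuous g) :
    Continuous fun θ => max (Real.log ‖g θ‖) 0 := by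
  have : Continuous fun θ => Real.posLog ‖g θ‖ := Real.continuous_posLog.comp hg.norm
  simpa [Real.posLog_apply, max_comm] using this

lemma lemB {g : ℂ → ℂ} (hg : DifferentiableOn ℂ g (ball 0 1)) {r : ℝ} (h0 : 0 < r) (h1 : r < 1)
    {K : ℝ} (hK : ∫ θ, max (Real.log ‖g ((r:ℂ) * pt θ)‖) 0 ∂m ≤ K) {δ : ℝ} (hδ : 0 < δ)
    (hδ1 : δ ≤ 1) {a : ℝ} (ha : a ≤ m.real {θ | ‖g ((r:ℂ) * pt θ)‖ ≤ δ}) {ρ : ℝ}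
    (hρ : ρ < 1) {z : ℂ} (hz : ‖z‖ ≤ ρ) :
    ‖g ((r:ℂ) * z)‖ ≤ Real.exp ((1 + ρ) / (1 - ρ) * K + (1 - ρ) / (1 + ρ) * (Real.log δ * a)) := by
  have hz1 : ‖z‖ < 1 := hz.trans_lt hρ
  have hρ0 : 0 ≤ ρ := (norm_nonneg z).trans hz
  have hgc := dil_cont hg h0 h1
  have hlogδ : Real.log δ ≤ 0 := Real.log_nonpos hδ.le hδ1
  set A := {θ | ‖g ((r:ℂ) * pt θ)‖ ≤ δ} with hA
  have hAm : MeasurableSet A := (isClosed_le hgc.norm continuous_const).measurableSet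
  refine (sh (dil hg h0 h1) hz1 hδ).trans (Real.exp_le_exp.2 ?_)
  have hc1 : (1 + ‖z‖) / (1 - ‖z‖) ≤ (1 + ρ) / (1 - ρ) := by
    rw [div_le_div_iff₀ (by linarith) (by linarith)]; nlinarith
  have hc2 : (1 - ρ) / (1 + ρ) ≤ (1 - ‖z‖) / (1 + ‖z‖) := by
    rw [div_le_div_iff₀ (by linarith) (by positivity)]; nlinarith
  have hcp : 0 ≤ (1 + ρ) / (1 - ρ) := div_nonneg (by linarith) (by linarith)
  have hcp2 : 0 ≤ (1 - ρ) / (1 + ρ) := div_nonneg (by linarith) (by linarith)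
  have hlc : Continuous fun θ => Real.log (max ‖g ((r:ℂ) * pt θ)‖ δ) :=
    Continuous.log (hgc.norm.max continuous_const) fun θ => (lt_max_of_lt_right hδ).ne'
  have i1 : Integrable (fun θ => (1 + ρ) / (1 - ρ) * max (Real.log ‖g ((r:ℂ) * pt θ)‖) 0) m :=
    (integrable_cont (logp_cont hgc)).const_mul _
  have i2 : Integrable (fun θ => (1 - ρ) / (1 + ρ) * A.indicator (fun _ => Real.log δ) θ) m :=
    ((integrable_const _).indicator hAm).const_mul _
  calc _ ≤ ∫ θ, ((1 + ρ) / (1 - ρ) * max (Real.log ‖g ((r:ℂ) * pt θ)‖) 0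
          + (1 - ρ) / (1 + ρ) * A.indicator (fun _ => Real.log δ) θ) ∂m := by
        refine integral_mono (integrable_cont ((pk_cont hz1).mul hlc)) (i1.add i2) fun θ => ?_
        have p1 := (pk_le hz1 θ).trans hc1
        have p2 := hc2.trans (le_pk hz1 θ)
        have p0 := pk_nonneg hz1 θ
        dsimp only
        by_cases hθ : θ ∈ A
        · rw [indicator_of_mem hθ, max_eq_right hθ]
          have : 0 ≤ (1 + ρ) / (1 - ρ) * max (Real.log ‖g ((r:ℂ) * pt θ)‖) 0 :=
            mul_nonneg hcp (le_max_right _ _)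
          nlinarith
        · rw [indicator_of_notMem hθ, max_eq_left (not_le.1 hθ).le, mul_zero, add_zero]
          calc _ ≤ poissonKernel 0 z (pt θ) * max (Real.log ‖g ((r:ℂ) * pt θ)‖) 0 :=
                mul_le_mul_of_nonneg_left (le_max_left _ _) p0
            _ ≤ _ := mul_le_mul_of_nonneg_right p1 (le_max_right _ _)
    _ = (1 + ρ) / (1 - ρ) * ∫ θ, max (Real.log ‖g ((r:ℂ) * pt θ)‖) 0 ∂m
          + (1 - ρ) / (1 + ρ) * (m.real A * Real.log δ) := by
        rw [integral_add i1 i2, integral_const_mul, integral_const_mul, integral_indicator_const _ hAm]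
        simp
    _ ≤ _ := by
        have := mul_le_mul_of_nonneg_left hK hcp
        have h3 : m.real A * Real.log δ ≤ Real.log δ * a := by nlinarith
        have := mul_le_mul_of_nonneg_left h3 hcp2
        linarith

lemma nonvanish {v : ℂ → ℂ} (hv : DifferentiableOn ℂ v (ball 0 1)) (hb : ∀ z ∈ ball (0:ℂ) 1, ‖v z‖ ≤ 1)
    (h0 : v 0 ≠ 0) {vs : CircT → ℂ}
    (hvs : ∀ᵐ θ ∂m, Tendsto (fun r : ℝ => v ((r : ℂ) * pt θ)) (𝓝[<] (1:ℝ)) (𝓝 (vs θ))) :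
    ∀ᵐ θ ∂m, vs θ ≠ 0 := by
  have hm : TendstoInMeasure m (fun k θ => v ((rk k : ℂ) * pt θ)) atTop vs := by
    refine tendstoInMeasure_of_tendsto_ae
      (fun k => (dil_cont hv (rk_pos k) (rk_lt k)).aestronglyMeasurable) ?_
    filter_upwards [hvs] with θ hθ using hθ.comp rk_tendsto'
  rw [tendstoInMeasure_iff_measureReal_norm] at hm
  set S := {θ | vs θ = 0} with hS
  have key : ∀ T : ℝ, 0 ≤ T → ‖v 0‖ ≤ Real.exp (- T * m.real S) := by
    intro T hT
    have hδ := Real.exp_pos (-T)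
    have h1 := hm _ hδ
    have h2 : Tendsto (fun k => Real.exp (-T * (m.real S - m.real {θ | Real.exp (-T) ≤ ‖v ((rk k : ℂ) * pt θ) - vs θ‖})))
        atTop (𝓝 (Real.exp (-T * (m.real S - 0)))) :=
      (Real.continuous_exp.tendsto _).comp (tendsto_const_nhds.mul (tendsto_const_nhds.sub h1))
    rw [sub_zero] at h2
    refine ge_of_tendsto' h2 fun k => ?_
    have h3 := lemB hv (rk_pos k) (rk_lt k) (K := 0) ?_ hδ (Real.exp_le_one_iff.2 (by linarith)) (a := m.real S - m.real {θ | Real.exp (-T) ≤ ‖v ((rk k : ℂ) * pt θ) - vs θ‖}) ?_ (ρ := 0) (by norm_num) (z := 0) (by simp)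
    · simpa using h3
    · refine le_of_eq ?_
      have : ∀ θ, max (Real.log ‖v ((rk k : ℂ) * pt θ)‖) 0 = 0 := fun θ =>
        max_eq_right (Real.log_nonpos (norm_nonneg _) (hb _ (mem_ball_mul (rk_pos k) (rk_lt k) (pt_norm θ).le)))
      simp [this]
    · rw [sub_le_iff_le_add]
      refine (measureReal_mono ?_).trans (measureReal_union_le _ _)
      intro θ hθ
      by_cases h : ‖v ((rk k : ℂ) * pt θ)‖ ≤ Real.exp (-T)
      · exact Or.inl h
      · right
        have : vs θ = 0 := hθ
        simp only [mem_ofPred_eq, this, sub_zero]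
        exact (not_le.1 h).le
  have hS0 : m.real S = 0 := by
    by_contra hne
    have hp : 0 < m.real S := lt_of_le_of_ne measureReal_nonneg (Ne.symm hne)
    have hv0 : 0 < ‖v 0‖ := norm_pos_iff.2 h0
    have hle : ‖v 0‖ ≤ 1 := hb _ (by simp)
    have hl : Real.log ‖v 0‖ ≤ 0 := Real.log_nonpos hv0.le hle
    have := key ((1 - Real.log ‖v 0‖) / m.real S) (div_nonneg (by linarith) hp.le)
    rw [← Real.log_le_iff_le_exp hv0] at this
    have e : -((1 - Real.log ‖v 0‖) / m.real S) * m.real S = -(1 - Real.log ‖v 0‖) := by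
      field_simp
    rw [e] at this
    linarith
  rw [ae_iff]
  simpa using (measureReal_eq_zero_iff).1 hS0

lemma logp_sub (a b : ℂ) : max (Real.log ‖a - b‖) 0 ≤ max (Real.log ‖a‖) 0 + max (Real.log ‖b‖) 0 + Real.log 2 := by
  have h := Real.posLog_norm_add_le a (-b)
  simp only [Real.posLog_apply, norm_neg, ← sub_eq_add_neg, max_comm (0:ℝ)] at h
  linarith

lemma inMeas {g : ℂ → ℂ} (hg : DifferentiableOn ℂ g (ball 0 1)) {gs : CircT → ℂ}
    (h : ∀ᵐ θ ∂m, Tendsto (fun r : ℝ => g ((r : ℂ) * pt θ)) (𝓝[<] (1:ℝ)) (𝓝 (gs θ))) :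
    TendstoInMeasure m (fun k θ => g ((rk k : ℂ) * pt θ)) atTop gs := by
  refine tendstoInMeasure_of_tendsto_ae
      (fun k => (dil_cont hg (rk_pos k) (rk_lt k)).aestronglyMeasurable) ?_
  filter_upwards [h] with θ hθ using hθ.comp rk_tendsto'

lemma cauchyB
    (f : ℕ → ℂ → ℂ)
    (hfan : ∀ n, DifferentiableOn ℂ (f n) (ball (0:ℂ) 1))
    (C : ℝ)
    (hbd : ∀ n, ∀ r : ℝ, 0 < r → r < 1 →
      ∫ θ, max (Real.log ‖f n ((r : ℂ) * pt θ)‖) 0 ∂m ≤ C)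
    (fs : ℕ → CircT → ℂ)
    (hfs : ∀ n, ∀ᵐ θ ∂m,
      Tendsto (fun r : ℝ => f n ((r : ℂ) * pt θ)) (𝓝[<] (1:ℝ)) (𝓝 (fs n θ)))
    (E : Set CircT) (hEmeas : MeasurableSet E) (hEpos : 0 < m E)
    (φ : CircT → ℂ)
    (hconv : TendstoInMeasure (m.restrict E) fs atTop φ) {ρ : ℝ} (hρ0 : 0 < ρ) (hρ : ρ < 1) {ε : ℝ}
    (hε : 0 < ε) :
    ∃ N, ∀ n ≥ N, ∀ n' ≥ N, ∀ z : ℂ, ‖z‖ ≤ ρ → ‖f n z - f n' z‖ ≤ ε := by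
  have hE : 0 < m.real E := ENNReal.toReal_pos hEpos.ne' (measure_ne_top _ _)
  set K : ℝ := C + C + Real.log 2 with hK
  obtain ⟨T, hT0, hT⟩ : ∃ T : ℝ, 0 ≤ T ∧
      Real.exp ((1 + ρ) / (1 - ρ) * K + (1 - ρ) / (1 + ρ) * (Real.log (Real.exp (-T)) * (m.real E / 2))) ≤ ε := by
    have hc : 0 < (1 - ρ) / (1 + ρ) * (m.real E / 2) :=
      mul_pos (div_pos (by linarith) (by linarith)) (by linarith)
    set c := (1 - ρ) / (1 + ρ) * (m.real E / 2) with hcdef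
    refine ⟨max 0 (((1 + ρ) / (1 - ρ) * K - Real.log ε) / c), le_max_left _ _, ?_⟩
    rw [← Real.le_log_iff_exp_le hε, Real.log_exp]
    have h1 := le_max_right 0 (((1 + ρ) / (1 - ρ) * K - Real.log ε) / c)
    rw [div_le_iff₀ hc] at h1
    set T := max 0 (((1 + ρ) / (1 - ρ) * K - Real.log ε) / c)
    have : (1 - ρ) / (1 + ρ) * (-T * (m.real E / 2)) = - (T * c) := by rw [hcdef]; ring
    rw [this]; linarith
  set δ := Real.exp (-T) with hδdef
  have hδ : 0 < δ := Real.exp_pos _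
  have hδ1 : δ ≤ 1 := Real.exp_le_one_iff.2 (by linarith)
  have h1 := (tendstoInMeasure_iff_measureReal_norm.1 hconv) (δ/4) (by positivity)
  obtain ⟨N, hN⟩ := eventually_atTop.1 (h1.eventually (gt_mem_nhds (show (0:ℝ) < m.real E / 8 by positivity)))
  refine ⟨N, fun n hn n' hn' z hz => ?_⟩
  have e1 := (tendstoInMeasure_iff_measureReal_norm.1 (inMeas (hfan n) (hfs n))) (δ/4) (by positivity)
  have e2 := (tendstoInMeasure_iff_measureReal_norm.1 (inMeas (hfan n') (hfs n'))) (δ/4) (by positivity)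
  have e1' := e1.eventually (gt_mem_nhds (show (0:ℝ) < m.real E / 8 by positivity))
  have e2' := e2.eventually (gt_mem_nhds (show (0:ℝ) < m.real E / 8 by positivity))
  have hg : DifferentiableOn ℂ (fun z => f n z - f n' z) (ball 0 1) := (hfan n).sub (hfan n')
  have hzb : z ∈ ball (0:ℂ) 1 := by simpa using hz.trans_lt hρ
  have hlim : Tendsto (fun k => ‖f n ((rk k : ℂ) * z) - f n' ((rk k : ℂ) * z)‖) atTop (𝓝 ‖f n z - f n' z‖) := by
    have hca : ContinuousAt (fun z => f n z - f n' z) z := (hg.differentiableAt (isOpen_ball.mem_nhds hzb)).continuousAt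
    have : Tendsto (fun k => (rk k : ℂ) * z) atTop (𝓝 z) := by
      have := ((continuous_ofReal.tendsto _).comp rk_tendsto).mul_const z
      simpa using this
    exact (hca.tendsto.comp this).norm
  refine le_of_tendsto hlim ?_
  filter_upwards [e1', e2'] with k hk1 hk2
  have hr0 := rk_pos k
  have hr1 := rk_lt k
  refine (lemB hg hr0 hr1 (K := K) ?_ hδ hδ1 (a := m.real E / 2) ?_ hρ hz).trans hT
  · have i1 := integrable_cont (logp_cont (dil_cont (hfan n) hr0 hr1))
    have i2 := integrable_cont (logp_cont (dil_cont (hfan n') hr0 hr1))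
    calc _ ≤ ∫ θ, (max (Real.log ‖f n ((rk k : ℂ) * pt θ)‖) 0 + max (Real.log ‖f n' ((rk k : ℂ) * pt θ)‖) 0 + Real.log 2) ∂m :=
          integral_mono (integrable_cont (logp_cont (dil_cont hg hr0 hr1))) ((i1.add i2).add (integrable_const _)) fun θ => logp_sub _ _
      _ = ∫ θ, max (Real.log ‖f n ((rk k : ℂ) * pt θ)‖) 0 ∂m + ∫ θ, max (Real.log ‖f n' ((rk k : ℂ) * pt θ)‖) 0 ∂m + Real.log 2 := by
          have i12 : Integrable (fun θ => max (Real.log ‖f n ((rk k : ℂ) * pt θ)‖) 0 + max (Real.log ‖f n' ((rk k : ℂ) * pt θ)‖) 0) m := i1.add i2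
          rw [integral_add i12 (integrable_const _), integral_add i1 i2]; simp
      _ ≤ K := by
          have := hbd n _ hr0 hr1
          have := hbd n' _ hr0 hr1
          linarith
  · have hk3 := hN n hn
    have hk4 := hN n' hn'
    rw [measureReal_restrict_apply' hEmeas] at hk3 hk4
    set A := {θ | ‖f n ((rk k : ℂ) * pt θ) - f n' ((rk k : ℂ) * pt θ)‖ ≤ δ}
    set B1 := {θ | δ / 4 ≤ ‖f n ((rk k : ℂ) * pt θ) - fs n θ‖}
    set B2 := {θ | δ / 4 ≤ ‖f n' ((rk k : ℂ) * pt θ) - fs n' θ‖}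
    set D1 := {θ | δ / 4 ≤ ‖fs n θ - φ θ‖} ∩ E
    set D2 := {θ | δ / 4 ≤ ‖fs n' θ - φ θ‖} ∩ E
    have hsub : E ⊆ A ∪ (B1 ∪ (B2 ∪ (D1 ∪ D2))) := by
      intro θ hθ
      by_contra hcon
      simp only [A, B1, B2, D1, D2, mem_union, mem_inter_iff, mem_ofPred_eq, not_or, not_le, hθ, and_true] at hcon
      obtain ⟨hA, hB1, hB2, hD1, hD2⟩ := hcon
      have : f n ((rk k : ℂ) * pt θ) - f n' ((rk k : ℂ) * pt θ) =
        (f n ((rk k : ℂ) * pt θ) - fs n θ) + (fs n θ - φ θ) - (fs n' θ - φ θ) - (f n' ((rk k : ℂ) * pt θ) - fs n' θ) := by ring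
      rw [this] at hA
      have n1 := norm_sub_le ((f n ((rk k : ℂ) * pt θ) - fs n θ) + (fs n θ - φ θ) - (fs n' θ - φ θ)) (f n' ((rk k : ℂ) * pt θ) - fs n' θ)
      have n2 := norm_sub_le ((f n ((rk k : ℂ) * pt θ) - fs n θ) + (fs n θ - φ θ)) (fs n' θ - φ θ)
      have n3 := norm_add_le (f n ((rk k : ℂ) * pt θ) - fs n θ) (fs n θ - φ θ)
      linarith
    have q0 := measureReal_mono (μ := m) hsub
    have q1 := measureReal_union_le (μ := m) A (B1 ∪ (B2 ∪ (D1 ∪ D2)))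
    have q2 := measureReal_union_le (μ := m) B1 (B2 ∪ (D1 ∪ D2))
    have q3 := measureReal_union_le (μ := m) B2 (D1 ∪ D2)
    have q4 := measureReal_union_le (μ := m) D1 D2
    linarith

lemma exists_limit
    (f : ℕ → ℂ → ℂ)
    (hfan : ∀ n, DifferentiableOn ℂ (f n) (ball (0:ℂ) 1))
    (hC : ∀ ρ : ℝ, 0 < ρ → ρ < 1 → ∀ ε : ℝ, 0 < ε →
      ∃ N, ∀ n ≥ N, ∀ n' ≥ N, ∀ z : ℂ, ‖z‖ ≤ ρ → ‖f n z - f n' z‖ ≤ ε) :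
    ∃ F : ℂ → ℂ, DifferentiableOn ℂ F (ball (0:ℂ) 1) ∧
      TendstoLocallyUniformlyOn f F atTop (ball (0:ℂ) 1) := by
  have hρ : ∀ z ∈ ball (0:ℂ) 1, ∃ ρ : ℝ, 0 < ρ ∧ ρ < 1 ∧ ‖z‖ < ρ := by
    intro z hz
    have hz' : ‖z‖ < 1 := by simpa using hz
    exact ⟨(1 + ‖z‖) / 2, by positivity, by linarith, by linarith⟩
  have hpt : ∀ z ∈ ball (0:ℂ) 1, ∃ l, Tendsto (fun n => f n z) atTop (𝓝 l) := by
    intro z hz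
    obtain ⟨ρ, h0, h1, hzρ⟩ := hρ z hz
    refine cauchySeq_tendsto_of_complete (Metric.cauchySeq_iff.2 fun ε hε => ?_)
    obtain ⟨N, hN⟩ := hC ρ h0 h1 (ε/2) (by linarith)
    exact ⟨N, fun n hn n' hn' => by rw [dist_eq_norm]; linarith [hN n hn n' hn' z hzρ.le]⟩
  choose! F hF using hpt
  have hloc : TendstoLocallyUniformlyOn f F atTop (ball (0:ℂ) 1) := by
    rw [Metric.tendstoLocallyUniformlyOn_iff]
    intro ε hε z hz
    obtain ⟨ρ, h0, h1, hzρ⟩ := hρ z hz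
    obtain ⟨N, hN⟩ := hC ρ h0 h1 (ε/2) (by linarith)
    refine ⟨ball 0 ρ, mem_nhdsWithin_of_mem_nhds (isOpen_ball.mem_nhds (by simpa using hzρ)), ?_⟩
    filter_upwards [eventually_ge_atTop N] with n hn y hy
    have hy' : ‖y‖ < ρ := by simpa using hy
    have hl : Tendsto (fun n' => ‖f n' y - f n y‖) atTop (𝓝 ‖F y - f n y‖) :=
      ((hF y (by simpa using hy'.trans h1)).sub_const _).norm
    have : ‖F y - f n y‖ ≤ ε / 2 := by
      refine le_of_tendsto hl ?_
      filter_upwards [eventually_ge_atTop N] with n' hn' using hN n' hn' n hn y hy'.le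
    rw [dist_eq_norm]; linarith
  exact ⟨F, hloc.differentiableOn (Eventually.of_forall hfan) isOpen_ball, hloc⟩


lemma montel {v : ℕ → ℂ → ℂ} (hv : ∀ n, DifferentiableOn ℂ (v n) (ball 0 1))
    (hb : ∀ n, ∀ z ∈ ball (0:ℂ) 1, ‖v n z‖ ≤ 1) :
    ∃ (s : ℕ → ℕ) (w : ℂ → ℂ), StrictMono s ∧ DifferentiableOn ℂ w (ball 0 1) ∧
      ∀ z ∈ ball (0:ℂ) 1, Tendsto (fun k => v (s k) z) atTop (𝓝 (w z)) := by
  let a : ℕ → ℕ → ℂ := fun n k => (k.factorial : ℂ)⁻¹ * iteratedDeriv k (v n) 0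
  have ha : ∀ n k, ‖a n k‖ ≤ 1 := by
    intro n k
    have hlim : Tendsto (fun j => (rk j) ^ k * ‖a n k‖) atTop (𝓝 (1 ^ k * ‖a n k‖)) :=
      (rk_tendsto.pow k).mul_const _
    rw [one_pow, one_mul] at hlim
    refine le_of_tendsto hlim (Eventually.of_forall fun j => ?_)
    have hsub : closedBall (0:ℂ) (rk j) ⊆ ball 0 1 := closedBall_subset_ball (rk_lt j)
    have hd : DiffContOnCl ℂ (v n) (ball 0 (rk j)) := by
      refine DifferentiableOn.diffContOnCl ((hv n).mono ?_)
      rw [closure_ball _ (rk_pos j).ne']; exact hsub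
    have h1 := norm_iteratedDeriv_le_of_forall_mem_sphere_norm_le k (rk_pos j) hd (C := 1)
      fun z hz => hb n z (hsub (sphere_subset_closedBall hz))
    have hp : 0 < rk j ^ k := pow_pos (rk_pos j) k
    have hf : (0:ℝ) < k.factorial := by positivity
    simp only [a, norm_mul, norm_inv, RCLike.norm_natCast]
    rw [le_div_iff₀ hp] at h1
    rw [← mul_assoc, mul_comm (rk j ^ k), mul_assoc, inv_mul_le_iff₀ hf]
    linarith
  have hK : IsCompact (Set.pi univ fun _ : ℕ => closedBall (0:ℂ) 1) :=
    isCompact_univ_pi fun _ => isCompact_closedBall _ _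
  obtain ⟨b, hb', s, hs, hlim⟩ := hK.tendsto_subseq (x := a) fun n => by
    simpa [Set.mem_pi] using ha n
  have hbk : ∀ k, ‖b k‖ ≤ 1 := by simpa [Set.mem_pi] using hb'
  have hlk := tendsto_pi_nhds.1 hlim
  refine ⟨s, fun z => ∑' k, b k * z ^ k, hs, ?_, ?_⟩
  · intro z hz
    have hz' : ‖z‖ < 1 := by simpa using hz
    obtain ⟨ρ, hρ, hρ1⟩ := exists_between hz'
    have hρ0 : 0 ≤ ρ := (norm_nonneg z).trans hρ.le
    have := differentiableOn_tsum_of_summable_norm (U := ball (0:ℂ) ρ) (F := fun k z => b k * z ^ k)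
      (summable_geometric_of_lt_one hρ0 hρ1) (fun i => by fun_prop) isOpen_ball ?_
    · exact (this.differentiableAt (isOpen_ball.mem_nhds (by simpa using hρ))).differentiableWithinAt
    · intro i w hw
      have hw' : ‖w‖ < ρ := by simpa using hw
      rw [norm_mul, norm_pow]
      calc _ ≤ 1 * ρ ^ i := by gcongr; exact hbk i
        _ = _ := one_mul _
  · intro z hz
    have hz' : ‖z‖ < 1 := by simpa using hz
    have he : ∀ n, v n z = ∑' k, a n k * z ^ k := by
      intro n
      have := (hasSum_taylorSeries_on_ball (hv n) hz).tsum_eq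
      rw [← this]
      refine tsum_congr fun k => ?_
      simp [a]; ring
    simp only [he]
    refine tendsto_tsum_of_dominated_convergence (bound := fun k => ‖z‖ ^ k)
      (summable_geometric_of_lt_one (norm_nonneg _) hz') (fun k => (hlk k).mul_const _)
      (Eventually.of_forall fun n k => ?_)
    rw [norm_mul, norm_pow]
    calc _ ≤ 1 * ‖z‖ ^ k := by gcongr; exact ha _ _
        _ = _ := one_mul _

lemma nt1 {e : ℂ → ℂ} (he : DiffContOnCl ℂ e (ball 0 1)) {M ε δ : ℝ} (hM : 0 ≤ M) (hε : 0 ≤ ε) (hδ : 0 < δ)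
    (h1 : ∀ w, ‖w‖ = 1 → ‖e w‖ ≤ M * ‖w - 1‖)
    (h2 : ∀ w, ‖w‖ = 1 → ‖w - 1‖ < δ → ‖e w‖ ≤ ε * ‖w - 1‖) {z : ℂ} (hz : ‖z‖ < 1) (hz1 : ‖z - 1‖ ≤ δ / 2) :
    ‖e z‖ ≤ (ε + M * ((1 - ‖z‖ ^ 2) * (4 / δ ^ 2))) * ‖z - 1‖ := by
  set B := ε + M * ((1 - ‖z‖ ^ 2) * (4 / δ ^ 2)) with hB
  have hzz : 0 ≤ 1 - ‖z‖ ^ 2 := by nlinarith [norm_nonneg z]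
  have hB0 : 0 ≤ B := by positivity
  have key : ∀ η : ℝ, 0 < η → ‖e z‖ ≤ B * ‖z - 1 - η‖ := by
    intro η hη
    have hre : ∀ w : ℂ, ‖w‖ ≤ 1 → ‖w - 1‖ ≤ ‖w - 1 - η‖ ∧ w - 1 - η ≠ 0 := by
      intro w hw
      have h3 : w.re ≤ 1 := (re_le_norm w).trans hw
      constructor
      · rw [← sq_le_sq₀ (norm_nonneg _) (norm_nonneg _), Complex.sq_norm, Complex.sq_norm, normSq_apply, normSq_apply]
        simp
        nlinarith
      · intro h0
        have := congrArg re h0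
        simp at this; linarith
    let q : ℂ → ℂ := fun w => (w - 1 - η)⁻¹ • e w
    have hq : DiffContOnCl ℂ q (ball 0 1) := by
      refine DiffContOnCl.smul (DiffContOnCl.inv (Differentiable.diffContOnCl (by fun_prop)) ?_) he
      intro w hw
      rw [closure_ball _ one_ne_zero] at hw
      exact (hre w (by simpa using hw)).2
    have hqn : ∀ w a, ‖w‖ = 1 → 0 ≤ a → ‖e w‖ ≤ a * ‖w - 1‖ → ‖q w‖ ≤ a := by
      intro w a hw ha h
      obtain ⟨h3, h4⟩ := hre w hw.le
      simp only [q, norm_smul, norm_inv]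
      rw [inv_mul_le_iff₀ (norm_pos_iff.2 h4), mul_comm]
      exact h.trans (by gcongr)
    have hqz : ‖q z‖ ≤ B := by
      rw [← poisson hq hz]
      calc _ ≤ ∫ θ, ‖poissonKernel 0 z (pt θ) • q (pt θ)‖ ∂m := norm_integral_le_integral_norm _
        _ ≤ ∫ θ, (ε * poissonKernel 0 z (pt θ) + M * ((1 - ‖z‖ ^ 2) * (4 / δ ^ 2))) ∂m := by
          refine integral_mono (integrable_cont ((pk_cont hz).smul (cont_circ hq)).norm)
            (integrable_cont ((continuous_const.mul (pk_cont hz)).add continuous_const)) fun θ => ?_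
          have hp := pk_nonneg hz θ
          have e1 := pt_norm θ
          simp only [norm_smul, Real.norm_eq_abs, abs_of_nonneg hp]
          by_cases hc : ‖pt θ - 1‖ < δ
          · have := hqn _ ε e1 hε (h2 _ e1 hc)
            have h5 : 0 ≤ M * ((1 - ‖z‖ ^ 2) * (4 / δ ^ 2)) := by positivity
            nlinarith
          · push Not at hc
            have h5 := hqn _ M e1 hM (h1 _ e1)
            have h6 : δ / 2 ≤ ‖pt θ - z‖ := by
              have := norm_sub_le_norm_sub_add_norm_sub (pt θ) z 1
              linarith
            have h7 : poissonKernel 0 z (pt θ) ≤ (1 - ‖z‖ ^ 2) * (4 / δ ^ 2) := by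
              rw [poissonKernel_def]
              simp only [sub_zero, e1, one_pow]
              calc _ ≤ (1 - ‖z‖ ^ 2) / (δ / 2) ^ 2 := by gcongr
                _ = _ := by field_simp; norm_num
            have h8 : 0 ≤ ε * poissonKernel 0 z (pt θ) := by positivity
            have h9 := mul_le_mul h7 h5 (norm_nonneg _) (by positivity)
            linarith
        _ = B := by
          rw [integral_add ((integrable_cont (pk_cont hz)).const_mul _) (integrable_const _), integral_const_mul, poisson_one hz]
          simp [hB]
    obtain ⟨h3, h4⟩ := hre z hz.le
    simp only [q, norm_smul, norm_inv] at hqz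
    rw [inv_mul_le_iff₀ (norm_pos_iff.2 h4), mul_comm] at hqz
    exact hqz
  have hl : Tendsto (fun η : ℝ => B * ‖z - 1 - η‖) (𝓝[>] 0) (𝓝 (B * ‖z - 1‖)) := by
    have : Continuous fun η : ℝ => B * ‖z - 1 - η‖ := by fun_prop
    have := (this.tendsto 0).mono_left (nhdsWithin_le_nhds (s := Ioi 0))
    simpa using this
  exact ge_of_tendsto hl (by filter_upwards [self_mem_nhdsWithin] with η hη using key η hη)

lemma nt {H : ℂ → ℂ} (hH : DiffContOnCl ℂ H (ball 0 1)) {L : ℝ}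
    (hL : ∀ w, ‖w‖ = 1 → ‖H w - H 1‖ ≤ L * ‖w - 1‖) {c : ℂ}
    (hc : ∀ ε > 0, ∃ δ > 0, ∀ w, ‖w‖ = 1 → ‖w - 1‖ < δ → ‖H w - H 1 - c * (w - 1)‖ ≤ ε * ‖w - 1‖) :
    Tendsto (fun r : ℝ => deriv H r) (𝓝[<] 1) (𝓝 c) := by
  let e : ℂ → ℂ := fun z => H z - H 1 - c * (z - 1)
  have he : DiffContOnCl ℂ e (ball 0 1) :=
    (hH.sub diffContOnCl_const).sub (Differentiable.diffContOnCl (by fun_prop))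
  set M := |L| + ‖c‖ with hM
  have hM0 : 0 ≤ M := by positivity
  have h1 : ∀ w, ‖w‖ = 1 → ‖e w‖ ≤ M * ‖w - 1‖ := by
    intro w hw
    have := norm_sub_le (H w - H 1) (c * (w - 1))
    rw [norm_mul] at this
    have h2 := hL w hw
    have h3 : L * ‖w - 1‖ ≤ |L| * ‖w - 1‖ := by gcongr; exact le_abs_self L
    simp only [e]; rw [hM]; linarith
  rw [Metric.tendsto_nhds]
  intro ε hε
  obtain ⟨δ, hδ, h2⟩ := hc (ε / 6) (by positivity)
  have hlim : Tendsto (fun r : ℝ => M * ((3 * (1 - r)) * (4 / δ ^ 2))) (𝓝[<] 1) (𝓝 0) := by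
    have : Continuous (fun r : ℝ => M * ((3 * (1 - r)) * (4 / δ ^ 2))) := by fun_prop
    have := (this.tendsto 1).mono_left (nhdsWithin_le_nhds (s := Iio 1))
    simpa using this
  filter_upwards [self_mem_nhdsWithin, hlim.eventually (gt_mem_nhds (show 0 < ε / 12 by positivity)),
    mem_nhdsWithin_of_mem_nhds (lt_mem_nhds (show (0:ℝ) < 1 by norm_num)),
    mem_nhdsWithin_of_mem_nhds (lt_mem_nhds (show 1 - δ / 3 < 1 by linarith))] with r hr hr2 hr0 hr3
  have hr' : r < 1 := hr
  have hr0' : 0 < r := hr0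
  have hr3' : 1 - δ / 3 < r := hr3
  set R := (1 - r) / 2 with hR
  have hR0 : 0 < R := by rw [hR]; linarith
  have hrn : ‖(r:ℂ)‖ = r := by simp [abs_of_pos hr0']
  have hr1n : ‖(r:ℂ) - 1‖ = 1 - r := by
    rw [← ofReal_one, ← ofReal_sub, norm_real, Real.norm_eq_abs, abs_of_neg (by linarith)]; ring
  have hin : ∀ z ∈ closedBall (r:ℂ) R, ‖z‖ < 1 ∧ ‖z - 1‖ ≤ 3 / 2 * (1 - r) := by
    intro z hz
    have hz' : ‖z - r‖ ≤ R := by simpa [dist_eq_norm] using hz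
    have a1 := norm_sub_le_norm_sub_add_norm_sub z r 0
    have a2 := norm_sub_le_norm_sub_add_norm_sub z r 1
    simp only [sub_zero] at a1
    constructor <;> linarith
  have hdc : DiffContOnCl ℂ e (ball (r:ℂ) R) := by
    refine DifferentiableOn.diffContOnCl (he.differentiableOn.mono ?_)
    rw [closure_ball _ hR0.ne']
    intro z hz
    simpa using (hin z hz).1
  have hd := norm_deriv_le_of_forall_mem_sphere_norm_le hR0 hdc (C := (ε / 6 + ε / 12) * (3 / 2 * (1 - r))) (by
    intro z hz
    obtain ⟨b1, b2⟩ := hin z (sphere_subset_closedBall hz)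
    have b3 := nt1 he hM0 (by positivity) hδ h1 h2 b1 (by linarith)
    have b4 : 1 - ‖z‖ ^ 2 ≤ 3 * (1 - r) := by
      have := norm_sub_norm_le (1:ℂ) z
      rw [norm_one, norm_sub_rev] at this
      nlinarith [norm_nonneg z]
    refine b3.trans ?_
    have b5 : M * ((1 - ‖z‖ ^ 2) * (4 / δ ^ 2)) ≤ ε / 12 := le_trans (by gcongr) hr2.le
    gcongr)
  have hHd : DifferentiableAt ℂ H r := hH.differentiableOn.differentiableAt (isOpen_ball.mem_nhds (by simpa [abs_of_pos hr0'] using hr'))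
  have hde : deriv e r = deriv H r - c := by
    have h : HasDerivAt e (deriv H r - c * 1) r :=
      (hHd.hasDerivAt.sub_const (H 1)).sub (((hasDerivAt_id (r:ℂ)).sub_const 1).const_mul c)
    simpa using h.deriv
  rw [hde] at hd
  rw [dist_eq_norm]
  refine hd.trans_lt ?_
  rw [div_lt_iff₀ hR0, hR]
  nlinarith


lemma ae_transfer {P : CircT → Prop} (h : ∀ᵐ t : ℝ, P (t : CircT)) : ∀ᵐ θ ∂m, P θ := by
  have h1 : ∀ᵐ θ : CircT, P θ := by
    have hmp := AddCircle.measurePreserving_equivIoc (T := 2 * π) (a := 0)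
    have h2 : ∀ᵐ x : ↥(Ioc (0:ℝ) (0 + 2 * π)) ∂(Measure.comap (Subtype.val : ↥(Ioc (0:ℝ) (0 + 2 * π)) → ℝ) volume), P ((x : ℝ) : CircT) := by
      refine ((MeasurableEmbedding.subtype_coe (measurableSet_Ioc (a := (0:ℝ)) (b := 0 + 2 * π))).ae_map_iff
        (p := fun t : ℝ => P (t : CircT))
        (μ := Measure.comap (Subtype.val : ↥(Ioc (0:ℝ) (0 + 2 * π)) → ℝ) volume)).1 ?_
      rw [map_comap_subtype_coe measurableSet_Ioc]
      exact ae_restrict_of_ae h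
    have h3 := hmp.quasiMeasurePreserving.ae h2
    filter_upwards [h3] with θ hθ
    have : (((AddCircle.equivIoc (2 * π) 0 θ : ℝ)) : CircT) = θ := AddCircle.coe_equivIoc ..
    rwa [this] at hθ
  rw [AddCircle.volume_eq_smul_haarAddCircle] at h1
  refine (Measure.absolutelyContinuous_smul ?_).ae_le h1
  simp [Real.pi_pos]

lemma circ_deriv {g : ℝ → ℂ} {t : ℝ} {γ : ℂ} (hg : HasDerivAt g γ t) :
    ∀ ε > 0, ∃ δ > 0, ∀ w : ℂ, ‖w‖ = 1 → ‖w - 1‖ < δ →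
      ‖g (t + arg w) - g t - (-I * γ) * (w - 1)‖ ≤ ε * ‖w - 1‖ := by
  have hlog : HasDerivAt log (1:ℂ)⁻¹ 1 := hasDerivAt_log (by simp [slitPlane])
  have hO : (fun w : ℂ => log w - log 1) =O[𝓝 1] fun w => w - 1 := hlog.isBigO_sub
  have ho : (fun w : ℂ => log w - log 1 - (w - 1) * 1⁻¹) =o[𝓝 1] fun w => w - 1 := by
    simpa using hlog.isLittleO
  have hargO : (fun w : ℂ => arg w) =O[𝓝 1] fun w => w - 1 := by
    refine Asymptotics.IsBigO.trans (Asymptotics.IsBigO.of_bound 1 (Eventually.of_forall fun w => ?_)) hO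
    rw [log_one, sub_zero, ← log_im, one_mul]
    exact abs_im_le_norm _
  have harg0 : Tendsto (fun w : ℂ => t + arg w) (𝓝 1) (𝓝 t) := by
    have := (continuousAt_arg (x := 1) (by simp [slitPlane])).tendsto.const_add t
    simpa using this
  have h1 : (fun w : ℂ => g (t + arg w) - g t - (arg w) • γ) =o[𝓝 1] fun w => w - 1 := by
    have := (hg.isLittleO.comp_tendsto harg0)
    have h2 : (fun w : ℂ => g (t + arg w) - g t - (arg w) • γ) =o[𝓝 1] fun w => arg w := by
      simpa [Function.comp_def] using this
    exact h2.trans_isBigO hargO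
  have h3 : (fun w : ℂ => (-I * γ) * (log w - log 1 - (w - 1) * 1⁻¹)) =o[𝓝 1] fun w => w - 1 :=
    ho.const_mul_left _
  have h4 := h1.add h3
  intro ε hε
  obtain ⟨δ, hδ, h5⟩ := Metric.eventually_nhds_iff.1 (h4.def hε)
  refine ⟨δ, hδ, fun w hw hwd => ?_⟩
  have h6 := h5 (y := w) (by simpa [dist_eq_norm] using hwd)
  have h7 : log w = (arg w) * I := by
    apply Complex.ext <;> simp [log_re, log_im, hw]
  have h8 : g (t + arg w) - g t - (-I * γ) * (w - 1) =
      g (t + w.arg) - g t - w.arg • γ + -I * γ * (log w - log 1 - (w - 1) * 1⁻¹) := by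
    rw [h7]
    simp
    linear_combination ((arg w : ℂ) * γ) * I_sq
  rw [h8]; exact h6

lemma fatou {u : ℂ → ℂ} (hu : DifferentiableOn ℂ u (ball 0 1)) (hb : ∀ z ∈ ball (0:ℂ) 1, ‖u z‖ ≤ 1) :
    ∃ us : CircT → ℂ, ∀ᵐ θ ∂m, Tendsto (fun r : ℝ => u ((r : ℂ) * pt θ)) (𝓝[<] (1:ℝ)) (𝓝 (us θ)) := by
  obtain ⟨G0, hG0⟩ := hu.isExactOn_ball
  have hLip : LipschitzOnWith 1 G0 (ball 0 1) :=
    (convex_ball (0:ℂ) 1).lipschitzOnWith_of_nnnorm_hasDerivWithin_le (𝕜 := ℂ)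
      (fun x hx => (hG0 x hx).hasDerivWithinAt) fun x hx => by
        rw [← NNReal.coe_le_coe]; simpa using hb x hx
  obtain ⟨G, hGL, hGe⟩ := hLip.extend_finite_dimension
  set K := lipschitzExtensionConstant ℂ * 1
  have hG : ∀ z ∈ ball (0:ℂ) 1, HasDerivAt G (u z) z := fun z hz =>
    (hG0 z hz).congr_of_eventuallyEq (by
      filter_upwards [isOpen_ball.mem_nhds hz] with y hy using (hGe hy).symm)
  let g : ℝ → ℂ := fun t => G (exp (t * I))
  have hexp : LipschitzWith 1 (fun t : ℝ => exp (t * I)) := by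
    have hd : ∀ t : ℝ, HasDerivAt (fun t : ℝ => exp (t * I)) (exp (t * I) * (1 * I)) t := fun t =>
      ((ofRealCLM.hasDerivAt (x := t)).mul_const I).cexp
    refine lipschitzWith_of_nnnorm_deriv_le (𝕜 := ℝ) (fun t => (hd t).differentiableAt) fun t => ?_
    rw [(hd t).deriv, ← NNReal.coe_le_coe]
    simp
  have hgL : LipschitzWith (K * 1) g := hGL.comp hexp
  have hdiff := hgL.ae_differentiableAt (μ := volume)
  have hex : ∀ᵐ θ ∂m, ∃ l, Tendsto (fun r : ℝ => u ((r : ℂ) * pt θ)) (𝓝[<] (1:ℝ)) (𝓝 l) := by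
    refine ae_transfer ?_
    filter_upwards [hdiff] with t ht
    have hg := ht.hasDerivAt
    set γ := deriv g t
    rw [pt_coe]
    set ζ := exp (t * I) with hζ
    have hζn : ‖ζ‖ = 1 := by simp [hζ, norm_exp]
    let H : ℂ → ℂ := fun z => G (ζ * z)
    have hHd : ∀ z ∈ ball (0:ℂ) 1, HasDerivAt H (u (ζ * z) * (ζ * 1)) z := by
      intro z hz
      refine HasDerivAt.comp z (h₂ := G) (hG (ζ * z) ?_) ((hasDerivAt_id z).const_mul ζ)
      simpa [hζn] using hz
    have hH : DiffContOnCl ℂ H (ball 0 1) :=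
      ⟨fun z hz => (hHd z hz).differentiableAt.differentiableWithinAt,
        (hGL.continuous.comp (continuous_const.mul continuous_id)).continuousOn⟩
    have hlim := nt hH (L := K) (c := -I * γ) ?_ ?_
    · refine ⟨(-I * γ) * ζ⁻¹, ?_⟩
      refine (hlim.mul_const ζ⁻¹).congr' ?_
      filter_upwards [self_mem_nhdsWithin, mem_nhdsWithin_of_mem_nhds (lt_mem_nhds (show (0:ℝ) < 1 by norm_num))] with r hr hr0
      have hr' : r < 1 := hr
      have hr0' : 0 < r := hr0
      rw [(hHd r (by simpa [abs_of_pos hr0'] using hr')).deriv, mul_one, mul_assoc, mul_inv_cancel₀ (by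
        intro h; simp [h] at hζn), mul_one, mul_comm]
    · intro w hw
      have := hGL.dist_le_mul (ζ * w) (ζ * 1)
      rw [dist_eq_norm, dist_eq_norm, ← mul_sub, norm_mul, hζn, one_mul] at this
      exact this
    · intro ε hε
      obtain ⟨δ, hδ, h⟩ := circ_deriv hg ε hε
      refine ⟨δ, hδ, fun w hw hwd => ?_⟩
      have h1 := h w hw hwd
      have h2 : g (t + arg w) = H w := by
        simp only [g, H, hζ]
        congr 1
        push_cast
        rw [add_mul, exp_add]
        have := norm_mul_exp_arg_mul_I w
        rw [hw, ofReal_one, one_mul] at this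
        rw [this]
      have h3 : g t = H 1 := by simp [g, H, hζ]
      rwa [h2, h3] at h1
  have : ∀ θ, ∃ l, (∃ l, Tendsto (fun r : ℝ => u ((r : ℂ) * pt θ)) (𝓝[<] (1:ℝ)) (𝓝 l)) →
      Tendsto (fun r : ℝ => u ((r : ℂ) * pt θ)) (𝓝[<] (1:ℝ)) (𝓝 l) := by
    intro θ
    by_cases h : ∃ l, Tendsto (fun r : ℝ => u ((r : ℂ) * pt θ)) (𝓝[<] (1:ℝ)) (𝓝 l)
    · obtain ⟨l, hl⟩ := h; exact ⟨l, fun _ => hl⟩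
    · exact ⟨0, fun h' => absurd h' h⟩
  choose us hus using this
  exact ⟨us, hex.mono fun θ h => hus θ h⟩


lemma scal {H : ℂ → ℂ} (hH : DiffContOnCl ℂ H (ball 0 1)) (j : ℤ) {r : ℝ} (h0 : 0 < r) (h1 : r < 1) :
    ∫ θ, H (pt θ) * pt θ ^ j ∂m = ∫ θ, H ((r:ℂ) * pt θ) * ((r:ℂ) * pt θ) ^ j ∂m := by
  have e1 := int_pt (fun w => H w * w ^ j)
  have e2 := int_pt (fun w => H ((r:ℂ) * w) * ((r:ℂ) * w) ^ j)
  have e3 : Real.circleAverage (fun w => H ((r:ℂ) * w) * ((r:ℂ) * w) ^ j) 0 1 =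
      Real.circleAverage (fun w => H w * w ^ j) 0 r := by
    simp [Real.circleAverage, circleMap]
  rw [e1, e2, e3, Real.circleAverage_eq_circleIntegral one_ne_zero, Real.circleAverage_eq_circleIntegral h0.ne']
  congr 1
  refine circleIntegral_sub_center_inv_smul_eq_of_differentiable_on_annulus_off_countable h0 h1.le
    (f := fun w => H w * w ^ j) countable_empty ?_ ?_
  · refine (hH.continuousOn.mono ?_).mul ?_
    · rw [closure_ball _ one_ne_zero]; exact sdiff_subset
    · intro z hz
      refine (continuousAt_zpow₀ z j (Or.inl ?_)).continuousWithinAt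
      rintro rfl
      exact hz.2 (by simpa using h0)
  · intro z hz
    have hz1 := hz.1.1
    have hz2 := hz.1.2
    refine (hH.differentiableOn.differentiableAt (isOpen_ball.mem_nhds hz1)).mul (differentiableAt_zpow.2 (Or.inl ?_))
    rintro rfl
    exact hz2 (by simpa using h0.le)

lemma weak1 {h : ℕ → ℂ → ℂ} (hd : ∀ n, DiffContOnCl ℂ (h n) (ball 0 1))
    (hb : ∀ n z, ‖z‖ ≤ 1 → ‖h n z‖ ≤ 1) {g : ℂ → ℂ} (hg : DifferentiableOn ℂ g (ball 0 1))
    (hgb : ∀ z ∈ ball (0:ℂ) 1, ‖g z‖ ≤ 1)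
    (hl : ∀ z ∈ ball (0:ℂ) 1, Tendsto (fun n => h n z) atTop (𝓝 (g z)))
    {gs : CircT → ℂ}
    (hgs : ∀ᵐ θ ∂m, Tendsto (fun r : ℝ => g ((r : ℂ) * pt θ)) (𝓝[<] (1:ℝ)) (𝓝 (gs θ))) (j : ℤ) :
    Tendsto (fun n => ∫ θ, h n (pt θ) * pt θ ^ j ∂m) atTop (𝓝 (∫ θ, gs θ * pt θ ^ j ∂m)) := by
  have p0 : (0:ℝ) < 1/2 := by norm_num
  have p1 : (1/2:ℝ) < 1 := by norm_num
  have hin : ∀ θ, ((1/2:ℝ):ℂ) * pt θ ∈ ball (0:ℂ) 1 := fun θ => mem_ball_mul p0 p1 (pt_norm θ).le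
  have hzc : ∀ c : ℂ, c ≠ 0 → Continuous fun θ => (c * pt θ) ^ j := fun c hc =>
    Continuous.zpow₀ (continuous_const.mul pt_cont) j fun θ => Or.inl (mul_ne_zero hc (pt_ne θ))
  have hzn : ∀ (c : ℂ) θ, ‖(c * pt θ) ^ j‖ = ‖c‖ ^ j := fun c θ => by
    rw [norm_zpow, norm_mul, pt_norm, mul_one]
  have hz1c : Continuous fun θ => pt θ ^ j := by simpa using hzc 1 one_ne_zero
  have hz1 : ∀ θ, ‖pt θ ^ j‖ = 1 := fun θ => by simpa using hzn 1 θ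
  have hne : ((1/2:ℝ):ℂ) ≠ 0 := by norm_num
  have key : ∫ θ, gs θ * pt θ ^ j ∂m = ∫ θ, g (((1/2:ℝ):ℂ) * pt θ) * (((1/2:ℝ):ℂ) * pt θ) ^ j ∂m := by
    have t1 : Tendsto (fun k => ∫ θ, g ((rk k : ℂ) * pt θ) * pt θ ^ j ∂m) atTop (𝓝 (∫ θ, gs θ * pt θ ^ j ∂m)) := by
      refine tendsto_integral_of_dominated_convergence (fun _ => (1:ℝ)) (fun k => ?_) (integrable_const _) (fun k => ?_) ?_
      · exact ((dil_cont hg (rk_pos k) (rk_lt k)).mul hz1c).aestronglyMeasurable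
      · refine Eventually.of_forall fun θ => ?_
        rw [norm_mul, hz1, mul_one]
        exact hgb _ (mem_ball_mul (rk_pos k) (rk_lt k) (pt_norm θ).le)
      · filter_upwards [hgs] with θ hθ using (hθ.comp rk_tendsto').mul_const _
    have t2 : Tendsto (fun k => ∫ θ, g ((rk k : ℂ) * (((1/2:ℝ):ℂ) * pt θ)) * (((1/2:ℝ):ℂ) * pt θ) ^ j ∂m) atTop
        (𝓝 (∫ θ, g (((1/2:ℝ):ℂ) * pt θ) * (((1/2:ℝ):ℂ) * pt θ) ^ j ∂m)) := by
      refine tendsto_integral_of_dominated_convergence (fun _ => ‖((1/2:ℝ):ℂ)‖ ^ j) (fun k => ?_) (integrable_const _) (fun k => ?_) ?_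
      · have := (dil_cont (dil hg (rk_pos k) (rk_lt k)).differentiableOn p0 p1).mul (hzc _ hne)
        exact this.aestronglyMeasurable
      · refine Eventually.of_forall fun θ => ?_
        rw [norm_mul, hzn]
        refine mul_le_of_le_one_left (by positivity) ?_
        exact hgb _ (mem_ball_mul (rk_pos k) (rk_lt k) (mem_ball_zero_iff.1 (hin θ)).le)
      · refine Eventually.of_forall fun θ => Tendsto.mul_const _ ?_
        have hca := (hg.differentiableAt (isOpen_ball.mem_nhds (hin θ))).continuousAt
        refine hca.tendsto.comp ?_
        have := ((continuous_ofReal.tendsto _).comp rk_tendsto).mul_const (((1/2:ℝ):ℂ) * pt θ)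
        simpa using this
    refine tendsto_nhds_unique t1 (t2.congr fun k => ?_)
    exact (scal (dil hg (rk_pos k) (rk_lt k)) j p0 p1).symm
  rw [key]
  simp only [fun n => scal (hd n) j p0 p1]
  refine tendsto_integral_of_dominated_convergence (fun _ => ‖((1/2:ℝ):ℂ)‖ ^ j) (fun k => ?_) (integrable_const _) (fun k => ?_) ?_
  · have := (dil_cont (hd k).differentiableOn p0 p1).mul (hzc _ hne)
    exact this.aestronglyMeasurable
  · refine Eventually.of_forall fun θ => ?_
    rw [norm_mul, hzn]
    refine mul_le_of_le_one_left (by positivity) ?_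
    exact hb _ _ (mem_ball_zero_iff.1 (hin θ)).le
  · exact Eventually.of_forall fun θ => (hl _ (hin θ)).mul_const _

lemma weak2 {A : ℕ → CircT → ℂ} {B : CircT → ℂ} (hA : ∀ n, AEStronglyMeasurable (A n) m)
    (hB : AEStronglyMeasurable B m) (hAb : ∀ n, ∀ᵐ θ ∂m, ‖A n θ‖ ≤ 1) (hBb : ∀ᵐ θ ∂m, ‖B θ‖ ≤ 1)
    (hj : ∀ j : ℤ, Tendsto (fun n => ∫ θ, A n θ * pt θ ^ j ∂m) atTop (𝓝 (∫ θ, B θ * pt θ ^ j ∂m)))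
    {q : CircT → ℂ} (hq : Integrable q m) :
    Tendsto (fun n => ∫ θ, A n θ * q θ ∂m) atTop (𝓝 (∫ θ, B θ * q θ ∂m)) := by
  have hint : ∀ {D : CircT → ℂ}, AEStronglyMeasurable D m → (∀ᵐ θ ∂m, ‖D θ‖ ≤ 1) →
      ∀ {q : CircT → ℂ}, Integrable q m → Integrable (fun θ => D θ * q θ) m :=
    fun hD hDb _ hq => hq.bdd_mul hD hDb
  let P : Lp ℂ 1 m → Prop := fun q =>
    Tendsto (fun n => ∫ θ, A n θ * q θ ∂m) atTop (𝓝 (∫ θ, B θ * q θ ∂m))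
  have hspan : ∀ q ∈ Submodule.span ℂ (range (@fourierLp (2 * π) _ 1 _)), P q := by
    intro q hq
    induction hq using Submodule.span_induction with
    | mem x hx =>
      obtain ⟨j, rfl⟩ := hx
      have hc := coeFn_fourierLp (T := 2 * π) 1 j
      have e : ∀ D : CircT → ℂ, ∫ θ, D θ * (fourierLp 1 j : Lp ℂ 1 m) θ ∂m = ∫ θ, D θ * pt θ ^ j ∂m := by
        intro D
        refine integral_congr_ae ?_
        filter_upwards [hc] with θ hθ
        rw [hθ, fourier_eq_pt]
      simp only [P, e]
      exact hj j
    | zero =>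
      have e : ∀ D : CircT → ℂ, ∫ θ, D θ * (0 : Lp ℂ 1 m) θ ∂m = 0 := by
        intro D
        rw [← integral_zero CircT ℂ (μ := m)]
        refine integral_congr_ae ?_
        filter_upwards [Lp.coeFn_zero ℂ 1 m] with θ hθ
        rw [hθ]; simp
      simp only [P, e]
      exact tendsto_const_nhds
    | add x y _ _ hx hy =>
      have e : ∀ D : CircT → ℂ, AEStronglyMeasurable D m → (∀ᵐ θ ∂m, ‖D θ‖ ≤ 1) →
          ∫ θ, D θ * (x + y : Lp ℂ 1 m) θ ∂m = ∫ θ, D θ * x θ ∂m + ∫ θ, D θ * y θ ∂m := by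
        intro D hD hDb
        rw [← integral_add (hint hD hDb (L1.integrable_coeFn x)) (hint hD hDb (L1.integrable_coeFn y))]
        refine integral_congr_ae ?_
        filter_upwards [Lp.coeFn_add x y] with θ hθ
        rw [hθ, Pi.add_apply, mul_add]
      simp only [P, e _ hB hBb, fun n => e _ (hA n) (hAb n)]
      exact hx.add hy
    | smul a x _ hx =>
      have e : ∀ D : CircT → ℂ, ∫ θ, D θ * (a • x : Lp ℂ 1 m) θ ∂m = a * ∫ θ, D θ * x θ ∂m := by
        intro D
        rw [← integral_const_mul]
        refine integral_congr_ae ?_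
        filter_upwards [Lp.coeFn_smul a x] with θ hθ
        simp [hθ]; ring
      simp only [P, e]
      exact hx.const_mul a
  have hall : ∀ q : Lp ℂ 1 m, P q := by
    intro q
    have hcl : q ∈ closure (Submodule.span ℂ (range (@fourierLp (2 * π) _ 1 _)) : Set (Lp ℂ 1 m)) := by
      have : q ∈ (Submodule.span ℂ (range (@fourierLp (2 * π) _ 1 _))).topologicalClosure := by
        rw [span_fourierLp_closure_eq_top (by simp)]; trivial
      exact this
    simp only [P]
    rw [Metric.tendsto_atTop]
    intro ε hε
    obtain ⟨q', hq', hd⟩ := Metric.mem_closure_iff.1 hcl (ε / 3) (by linarith)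
    have hP := hspan q' hq'
    simp only [P] at hP
    obtain ⟨N, hN⟩ := Metric.tendsto_atTop.1 hP (ε / 3) (by linarith)
    have hdiff : ∀ D : CircT → ℂ, AEStronglyMeasurable D m → (∀ᵐ θ ∂m, ‖D θ‖ ≤ 1) →
        dist (∫ θ, D θ * q θ ∂m) (∫ θ, D θ * q' θ ∂m) < ε / 3 := by
      intro D hD hDb
      refine lt_of_le_of_lt ?_ hd
      have i1 := hint hD hDb (L1.integrable_coeFn q)
      have i2 := hint hD hDb (L1.integrable_coeFn q')
      rw [dist_eq_norm, ← integral_sub i1 i2, dist_eq_norm, L1.norm_eq_integral_norm]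
      refine norm_integral_le_of_norm_le (L1.integrable_coeFn _).norm ?_
      filter_upwards [hDb, Lp.coeFn_sub q q'] with θ h1 h2
      rw [h2, ← mul_sub, norm_mul]
      exact mul_le_of_le_one_left (norm_nonneg _) h1
    refine ⟨N, fun n hn => ?_⟩
    have d1 := hdiff _ (hA n) (hAb n)
    have d2 := hdiff _ hB hBb
    have d3 := hN n hn
    rw [dist_comm] at d2
    have := dist_triangle4 (∫ θ, A n θ * q θ ∂m) (∫ θ, A n θ * q' θ ∂m) (∫ θ, B θ * q' θ ∂m) (∫ θ, B θ * q θ ∂m)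
    linarith
  have := hall (hq.toL1 q)
  have e : ∀ D : CircT → ℂ, ∫ θ, D θ * (hq.toL1 q) θ ∂m = ∫ θ, D θ * q θ ∂m := by
    intro D
    refine integral_congr_ae ?_
    filter_upwards [hq.coeFn_toL1] with θ hθ
    rw [hθ]
  simpa only [P, e] using this


lemma stepF {U V : ℕ → CircT → ℂ} {us ws : CircT → ℂ}
    (hUm : ∀ n, AEStronglyMeasurable (U n) m) (hVm : ∀ n, AEStronglyMeasurable (V n) m)
    (hum : AEStronglyMeasurable us m) (hwm : AEStronglyMeasurable ws m)
    (hUb : ∀ n, ∀ᵐ θ ∂m, ‖U n θ‖ ≤ 1) (hVb : ∀ n, ∀ᵐ θ ∂m, ‖V n θ‖ ≤ 1)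
    (hub : ∀ᵐ θ ∂m, ‖us θ‖ ≤ 1) (hwb : ∀ᵐ θ ∂m, ‖ws θ‖ ≤ 1)
    (hU : ∀ q, Integrable q m → Tendsto (fun n => ∫ θ, U n θ * q θ ∂m) atTop (𝓝 (∫ θ, us θ * q θ ∂m)))
    (hV : ∀ q, Integrable q m → Tendsto (fun n => ∫ θ, V n θ * q θ ∂m) atTop (𝓝 (∫ θ, ws θ * q θ ∂m)))
    {E : Set CircT} (hE : MeasurableSet E) {φ : CircT → ℂ}
    (hlim : ∀ᵐ θ ∂(m.restrict E), Tendsto (fun n => U n θ - V n θ * φ θ) atTop (𝓝 0))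
    (hφ : StronglyMeasurable φ) :
    ∀ᵐ θ ∂(m.restrict E), us θ = ws θ * φ θ := by
  let b : CircT → ℝ := fun θ => (1 + ‖φ θ‖)⁻¹
  have hbm : StronglyMeasurable b := (stronglyMeasurable_const.add hφ.norm).inv₀
  have hbpos : ∀ θ, 0 < b θ := fun θ => by positivity
  have hb1 : ∀ θ, b θ ≤ 1 := fun θ => inv_le_one_of_one_le₀ (by linarith [norm_nonneg (φ θ)])
  have hφb : ∀ θ, ‖φ θ‖ * b θ ≤ 1 := fun θ => by
    rw [← div_eq_mul_inv, div_le_one (by positivity)]; linarith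
  let d : CircT → ℂ := fun θ => (us θ - ws θ * φ θ) * b θ
  have hbc : AEStronglyMeasurable (fun θ => (b θ : ℂ)) m := (continuous_ofReal.comp_stronglyMeasurable hbm).aestronglyMeasurable
  have hdm : AEStronglyMeasurable d m :=
    (hum.sub (hwm.mul hφ.aestronglyMeasurable)).mul hbc
  have hdb : ∀ᵐ θ ∂m, ‖d θ‖ ≤ 2 := by
    filter_upwards [hub, hwb] with θ h1 h2
    have e : d θ = us θ * b θ - ws θ * (φ θ * b θ) := by simp only [d]; ring
    rw [e]
    refine (norm_sub_le _ _).trans ?_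
    simp only [norm_mul, norm_real, Real.norm_eq_abs, abs_of_pos (hbpos θ)]
    have a1 := mul_le_mul h1 (hb1 θ) (hbpos θ).le zero_le_one
    have a2 := mul_le_mul h2 (hφb θ) (mul_nonneg (norm_nonneg _) (hbpos θ).le) zero_le_one
    linarith
  let q0 : CircT → ℂ := E.indicator fun θ => (starRingEnd ℂ) (d θ) * b θ
  let q1 : CircT → ℂ := fun θ => φ θ * q0 θ
  have hq0m : AEStronglyMeasurable q0 m :=
    ((continuous_conj.comp_aestronglyMeasurable hdm).mul hbc).indicator hE
  have hq1m : AEStronglyMeasurable q1 m := hφ.aestronglyMeasurable.mul hq0m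
  have hq0b : ∀ᵐ θ ∂m, ‖q0 θ‖ ≤ 2 * b θ := by
    filter_upwards [hdb] with θ h
    refine (norm_indicator_le_norm_self _ _).trans ?_
    simp only [norm_mul, norm_real, Real.norm_eq_abs, abs_of_pos (hbpos θ), RCLike.norm_conj]
    exact mul_le_mul_of_nonneg_right h (hbpos θ).le
  have hq0b' : ∀ᵐ θ ∂m, ‖q0 θ‖ ≤ 2 := by
    filter_upwards [hq0b] with θ h
    linarith [hb1 θ]
  have hq1b : ∀ᵐ θ ∂m, ‖q1 θ‖ ≤ 2 := by
    filter_upwards [hq0b] with θ h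
    simp only [q1, norm_mul]
    have := mul_le_mul_of_nonneg_left h (norm_nonneg (φ θ))
    linarith [hφb θ]
  have hq0i : Integrable q0 m := Integrable.of_bound hq0m 2 hq0b'
  have hq1i : Integrable q1 m := Integrable.of_bound hq1m 2 hq1b
  have t1 := (hU q0 hq0i).sub (hV q1 hq1i)
  have hint : ∀ {D q : CircT → ℂ}, AEStronglyMeasurable D m → (∀ᵐ θ ∂m, ‖D θ‖ ≤ 1) →
      Integrable q m → Integrable (fun θ => D θ * q θ) m :=
    fun hD hDb hq => hq.bdd_mul hD hDb
  have t2 : Tendsto (fun n => ∫ θ, (U n θ * q0 θ - V n θ * q1 θ) ∂m) atTop (𝓝 (∫ θ, (0:ℂ) ∂m)) := by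
    refine tendsto_integral_of_dominated_convergence (fun _ => (4:ℝ)) (fun n => ?_) (integrable_const _) (fun n => ?_) ?_
    · exact ((hUm n).mul hq0m).sub ((hVm n).mul hq1m)
    · filter_upwards [hUb n, hVb n, hq0b', hq1b] with θ h1 h2 h3 h4
      refine (norm_sub_le _ _).trans ?_
      rw [norm_mul, norm_mul]
      have a1 := mul_le_mul h1 h3 (norm_nonneg _) zero_le_one
      have a2 := mul_le_mul h2 h4 (norm_nonneg _) zero_le_one
      linarith
    · filter_upwards [(ae_restrict_iff' hE).1 hlim] with θ h
      by_cases hθ : θ ∈ E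
      · have := (h hθ).mul_const (q0 θ)
        rw [zero_mul] at this
        refine this.congr fun n => ?_
        simp only [q1]; ring
      · have : q0 θ = 0 := indicator_of_notMem hθ _
        simp [q1, this]
  simp only [fun n => integral_sub (hint (hUm n) (hUb n) hq0i) (hint (hVm n) (hVb n) hq1i)] at t2
  have t3 := tendsto_nhds_unique t1 t2
  rw [← integral_sub (hint hum hub hq0i) (hint hwm hwb hq1i)] at t3
  let s : CircT → ℝ := E.indicator fun θ => ‖d θ‖ ^ 2
  have hs : ∀ θ, us θ * q0 θ - ws θ * q1 θ = ((s θ : ℝ) : ℂ) := by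
    intro θ
    by_cases hθ : θ ∈ E
    · have e0 : q0 θ = (starRingEnd ℂ) (d θ) * b θ := indicator_of_mem hθ _
      have e1 : s θ = ‖d θ‖ ^ 2 := indicator_of_mem hθ _
      have e2 : us θ * q0 θ - ws θ * q1 θ = d θ * (starRingEnd ℂ) (d θ) := by
        simp only [q1, e0]
        have : d θ = (us θ - ws θ * φ θ) * b θ := rfl
        generalize (starRingEnd ℂ) (d θ) = y
        rw [this]; ring
      rw [e2, e1, mul_conj, normSq_eq_norm_sq]
    · have e0 : q0 θ = 0 := indicator_of_notMem hθ _
      have e1 : s θ = 0 := indicator_of_notMem hθ _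
      simp [q1, e0, e1]
  simp only [hs, integral_zero] at t3
  rw [integral_complex_ofReal] at t3
  have t4 : ∫ θ, s θ ∂m = 0 := by exact_mod_cast t3
  have hsi : Integrable s m := by
    refine Integrable.of_bound ((hdm.norm.pow 2).indicator hE) 4 ?_
    filter_upwards [hdb] with θ h
    refine (norm_indicator_le_norm_self _ _).trans ?_
    rw [norm_pow, norm_norm]
    nlinarith [norm_nonneg (d θ)]
  have hs0 : ∀ θ, 0 ≤ s θ := fun θ => indicator_nonneg (fun _ _ => by positivity) _
  have t5 := (integral_eq_zero_iff_of_nonneg hs0 hsi).1 t4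
  rw [ae_restrict_iff' hE]
  filter_upwards [t5] with θ h hθ
  have e1 : s θ = ‖d θ‖ ^ 2 := indicator_of_mem hθ _
  rw [e1] at h
  have h2 : d θ = 0 := by simpa using h
  have h3 : (b θ : ℂ) ≠ 0 := by exact_mod_cast (hbpos θ).ne'
  have h4 := (mul_eq_zero.1 h2).resolve_right h3
  exact sub_eq_zero.1 h4


lemma radial_bound {g : ℂ → ℂ} (hb : ∀ z ∈ ball (0:ℂ) 1, ‖g z‖ ≤ 1) {θ : CircT} {l : ℂ}
    (h : Tendsto (fun r : ℝ => g ((r : ℂ) * pt θ)) (𝓝[<] (1:ℝ)) (𝓝 l)) : ‖l‖ ≤ 1 :=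
  le_of_tendsto (h.comp rk_tendsto').norm (Eventually.of_forall fun k =>
    hb _ (mem_ball_mul (rk_pos k) (rk_lt k) (pt_norm θ).le))

lemma radial_meas {g : ℂ → ℂ} (hg : DifferentiableOn ℂ g (ball 0 1)) {gs : CircT → ℂ}
    (h : ∀ᵐ θ ∂m, Tendsto (fun r : ℝ => g ((r : ℂ) * pt θ)) (𝓝[<] (1:ℝ)) (𝓝 (gs θ))) :
    AEStronglyMeasurable gs m :=
  aestronglyMeasurable_of_tendsto_ae atTop
    (fun k => (dil_cont hg (rk_pos k) (rk_lt k)).aestronglyMeasurable)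
    (by filter_upwards [h] with θ hθ using hθ.comp rk_tendsto')

/-- Outer-type factor. -/
lemma factor {g : ℂ → ℂ} (hg : DiffContOnCl ℂ g (ball 0 1)) {C : ℝ}
    (hC : ∫ θ, max (Real.log ‖g (pt θ)‖) 0 ∂m ≤ C) :
    ∃ V : ℂ → ℂ, Differentiable ℂ V ∧ (∀ z, ‖z‖ ≤ 1 → ‖V z‖ ≤ 1) ∧
      (∀ z, ‖z‖ ≤ 1 → ‖V z * g z‖ ≤ 1) ∧ Real.exp (-(C + 1)) ≤ ‖V 0‖ := by
  have hLc := logp_cont (cont_circ hg)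
  obtain ⟨p, hp, hpa⟩ := approx ⟨fun θ => max (Real.log ‖g (pt θ)‖) 0 + 1 / 2, by fun_prop⟩
    (show (0:ℝ) < 1 / 2 by norm_num)
  have h1 : ∀ θ, max (Real.log ‖g (pt θ)‖) 0 ≤ (p (pt θ)).re := fun θ => by
    have := (abs_lt.1 (hpa θ)).2
    simp only [ContinuousMap.coe_mk] at this
    linarith
  have h2 : ∀ θ, (p (pt θ)).re ≤ max (Real.log ‖g (pt θ)‖) 0 + 1 := fun θ => by
    have := (abs_lt.1 (hpa θ)).1
    simp only [ContinuousMap.coe_mk] at this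
    linarith
  have hn : ∀ z, ‖exp (-p z)‖ = (Real.exp (p z).re)⁻¹ := fun z => by
    rw [norm_exp, neg_re, Real.exp_neg]
  refine ⟨fun z => exp (-p z), by fun_prop, fun z hz => ?_, fun z hz => ?_, ?_⟩
  · have := majorant (g := fun _ => 1) diffContOnCl_const hp (fun θ => by
      rw [norm_one]; exact Real.one_le_exp ((le_max_right _ _).trans (h1 θ))) hz
    rw [norm_one] at this
    rw [hn]
    exact inv_le_one_of_one_le₀ this
  · have := majorant hg hp (fun θ => by
      refine le_trans ?_ (Real.exp_le_exp.2 ((le_max_left _ _).trans (h1 θ)))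
      exact Real.le_exp_log _) hz
    rw [norm_mul, hn, inv_mul_le_iff₀ (Real.exp_pos _), mul_one]
    exact this
  · have h3 := poisson_re hp (z := 0) (by simp)
    have h4 : ∀ θ, poissonKernel 0 0 (pt θ) = 1 := fun θ => by simp [poissonKernel_def, pt_norm]
    simp only [h4, one_mul] at h3
    rw [norm_exp, neg_re]
    refine Real.exp_le_exp.2 (neg_le_neg ?_)
    rw [← h3]
    calc _ ≤ ∫ θ, (max (Real.log ‖g (pt θ)‖) 0 + 1) ∂m :=
          integral_mono (integrable_cont (continuous_re.comp (hp.continuous.comp pt_cont)))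
            (integrable_cont (hLc.add continuous_const)) h2
      _ = ∫ θ, max (Real.log ‖g (pt θ)‖) 0 ∂m + 1 := by
          rw [integral_add (integrable_cont hLc) (integrable_const _)]; simp
      _ ≤ C + 1 := by linarith

lemma boundary
    (f : ℕ → ℂ → ℂ)
    (hfan : ∀ n, DifferentiableOn ℂ (f n) (ball (0:ℂ) 1))
    (C : ℝ)
    (hbd : ∀ n, ∀ r : ℝ, 0 < r → r < 1 →
      ∫ θ, max (Real.log ‖f n ((r : ℂ) * pt θ)‖) 0 ∂m ≤ C)
    (fs : ℕ → CircT → ℂ)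
    (hfs : ∀ n, ∀ᵐ θ ∂m,
      Tendsto (fun r : ℝ => f n ((r : ℂ) * pt θ)) (𝓝[<] (1:ℝ)) (𝓝 (fs n θ)))
    (E : Set CircT) (hEmeas : MeasurableSet E)
    (φ : CircT → ℂ)
    (hconv : TendstoInMeasure (m.restrict E) fs atTop φ)
    (F : ℂ → ℂ) (hF : DifferentiableOn ℂ F (ball (0:ℂ) 1))
    (hloc : TendstoLocallyUniformlyOn f F atTop (ball (0:ℂ) 1)) :
      ∃ Fs : CircT → ℂ,
        (∀ᵐ θ ∂m,
          Tendsto (fun r : ℝ => F ((r : ℂ) * pt θ)) (𝓝[<] (1:ℝ)) (𝓝 (Fs θ))) ∧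
        ∀ᵐ θ ∂(m.restrict E), Fs θ = φ θ := by
  have hK : ∀ n : ℕ, ∃ k ≥ n, m.real {θ | 1 / ((n:ℝ) + 1) ≤ ‖f n ((rk k : ℂ) * pt θ) - fs n θ‖} < 1 / ((n:ℝ) + 1) := by
    intro n
    have hp : (0:ℝ) < 1 / ((n:ℝ) + 1) := by positivity
    have e1 := ((tendstoInMeasure_iff_measureReal_norm.1 (inMeas (hfan n) (hfs n))) _ hp).eventually (gt_mem_nhds hp)
    obtain ⟨k, h1, h2⟩ := ((eventually_ge_atTop n).and e1).exists
    exact ⟨k, h1, h2⟩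
  choose K hKn hKm using hK
  have hKt : Tendsto K atTop atTop := tendsto_atTop_mono hKn tendsto_id
  set R : ℕ → ℝ := fun n => rk (K n) with hRdef
  have hR0 : ∀ n, 0 < R n := fun n => rk_pos _
  have hR1 : ∀ n, R n < 1 := fun n => rk_lt _
  have hRt : Tendsto R atTop (𝓝 1) := rk_tendsto.comp hKt
  let ψ : ℕ → CircT → ℂ := fun n θ => f n ((R n : ℂ) * pt θ)
  have hψ : TendstoInMeasure (m.restrict E) ψ atTop φ := by
    rw [tendstoInMeasure_iff_measureReal_norm] at hconv ⊢
    intro ε hε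
    have c1 := hconv (ε / 2) (by linarith)
    have c2 : Tendsto (fun n : ℕ => 1 / ((n:ℝ) + 1)) atTop (𝓝 0) := tendsto_one_div_add_atTop_nhds_zero_nat
    have c3 := c2.add c1
    rw [add_zero] at c3
    refine squeeze_zero' (Eventually.of_forall fun n => measureReal_nonneg) ?_ c3
    filter_upwards [c2.eventually (gt_mem_nhds (show 0 < ε / 2 by linarith))] with n hn
    have hsub : {θ | ε ≤ ‖ψ n θ - φ θ‖} ⊆ {θ | 1 / ((n:ℝ) + 1) ≤ ‖f n ((R n : ℂ) * pt θ) - fs n θ‖} ∪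
        {θ | ε / 2 ≤ ‖fs n θ - φ θ‖} := by
      intro θ hθ
      by_contra hcon
      simp only [mem_union, mem_ofPred_eq, not_or, not_le] at hcon hθ
      have := norm_sub_le_norm_sub_add_norm_sub (ψ n θ) (fs n θ) (φ θ)
      simp only [ψ] at this hθ
      linarith [hcon.1, hcon.2]
    have q0 := measureReal_mono (μ := m.restrict E) hsub
    have q1 := measureReal_union_le (μ := m.restrict E) {θ | 1 / ((n:ℝ) + 1) ≤ ‖f n ((R n : ℂ) * pt θ) - fs n θ‖}
        {θ | ε / 2 ≤ ‖fs n θ - φ θ‖}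
    have q2 : (m.restrict E).real {θ | 1 / ((n:ℝ) + 1) ≤ ‖f n ((R n : ℂ) * pt θ) - fs n θ‖} ≤
        m.real {θ | 1 / ((n:ℝ) + 1) ≤ ‖f n ((R n : ℂ) * pt θ) - fs n θ‖} := by
      rw [measureReal_restrict_apply' hEmeas]
      exact measureReal_mono inter_subset_left
    have q3 := hKm n
    linarith
  obtain ⟨ns, hns, hae⟩ := hψ.exists_seq_tendsto_ae
  have hdil : ∀ n, DiffContOnCl ℂ (fun z => f n ((R n : ℂ) * z)) (ball 0 1) := fun n => dil (hfan n) (hR0 n) (hR1 n)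
  choose V hVd hVb hUb hV0 using fun n => factor (hdil n) (hbd n (R n) (hR0 n) (hR1 n))
  obtain ⟨s, w, hs, hw, hwl⟩ := montel (v := fun n => V (ns n)) (fun n => (hVd _).differentiableOn)
    fun n z hz => hVb _ z (mem_ball_zero_iff.1 hz).le
  set σ : ℕ → ℕ := fun k => ns (s k) with hσ
  have hσm : StrictMono σ := hns.comp hs
  have hσt := hσm.tendsto_atTop
  have hwb : ∀ z ∈ ball (0:ℂ) 1, ‖w z‖ ≤ 1 := fun z hz =>
    le_of_tendsto (hwl z hz).norm (Eventually.of_forall fun k => hVb _ z (mem_ball_zero_iff.1 hz).le)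
  have hw0 : w 0 ≠ 0 := by
    have : Real.exp (-(C + 1)) ≤ ‖w 0‖ :=
      ge_of_tendsto (hwl 0 (by simp)).norm (Eventually.of_forall fun k => hV0 _)
    exact norm_pos_iff.1 ((Real.exp_pos _).trans_le this)
  have hUl : ∀ z ∈ ball (0:ℂ) 1, Tendsto (fun k => V (σ k) z * f (σ k) ((R (σ k) : ℂ) * z)) atTop (𝓝 (w z * F z)) := by
    intro z hz
    refine (hwl z hz).mul ?_
    have t1 : Tendsto (fun n => (R n : ℂ) * z) atTop (𝓝 z) := by
      have := ((continuous_ofReal.tendsto _).comp hRt).mul_const z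
      simpa using this
    have t2 : Tendsto (fun n => (R n : ℂ) * z) atTop (𝓝[ball 0 1] z) :=
      tendsto_nhdsWithin_iff.2 ⟨t1, Eventually.of_forall fun n =>
        mem_ball_mul (hR0 n) (hR1 n) (mem_ball_zero_iff.1 hz).le⟩
    exact (hloc.tendsto_comp (hF.continuousOn z hz) hz t2).comp hσt
  have hud : DifferentiableOn ℂ (fun z => w z * F z) (ball 0 1) := hw.mul hF
  have hub : ∀ z ∈ ball (0:ℂ) 1, ‖w z * F z‖ ≤ 1 := fun z hz =>
    le_of_tendsto (hUl z hz).norm (Eventually.of_forall fun k => hUb _ z (mem_ball_zero_iff.1 hz).le)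
  obtain ⟨ws, hws⟩ := fatou hw hwb
  obtain ⟨us, hus⟩ := fatou hud hub
  have hws0 := nonvanish hw hwb hw0 hws
  refine ⟨fun θ => us θ / ws θ, ?_, ?_⟩
  · filter_upwards [hws, hus, hws0] with θ h1 h2 h3
    refine (h2.div h1 h3).congr' ?_
    filter_upwards [h1.eventually_ne h3] with r hr
    exact mul_div_cancel_left₀ _ hr
  · have hφm : AEStronglyMeasurable φ (m.restrict E) :=
      aestronglyMeasurable_of_tendsto_ae atTop
        (fun k => (dil_cont (hfan (ns k)) (hR0 (ns k)) (hR1 (ns k))).aestronglyMeasurable) hae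
    have hUdc : ∀ n, DiffContOnCl ℂ (fun z => V n z * f n ((R n : ℂ) * z)) (ball 0 1) := fun n =>
      (hVd n).diffContOnCl.smul (hdil n)
    have hUm : ∀ k, AEStronglyMeasurable (fun θ => V (σ k) (pt θ) * f (σ k) ((R (σ k) : ℂ) * pt θ)) m :=
      fun k => (cont_circ (hUdc (σ k))).aestronglyMeasurable
    have hVm : ∀ k, AEStronglyMeasurable (fun θ => V (σ k) (pt θ)) m :=
      fun k => ((hVd (σ k)).continuous.comp pt_cont).aestronglyMeasurable
    have hum := radial_meas hud hus
    have hwm := radial_meas hw hws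
    have a1 : ∀ k, ∀ᵐ θ ∂m, ‖V (σ k) (pt θ) * f (σ k) ((R (σ k) : ℂ) * pt θ)‖ ≤ 1 :=
      fun k => Eventually.of_forall fun θ => hUb _ _ (pt_norm θ).le
    have a2 : ∀ k, ∀ᵐ θ ∂m, ‖V (σ k) (pt θ)‖ ≤ 1 :=
      fun k => Eventually.of_forall fun θ => hVb _ _ (pt_norm θ).le
    have a3 : ∀ᵐ θ ∂m, ‖us θ‖ ≤ 1 := hus.mono fun θ h => radial_bound hub h
    have a4 : ∀ᵐ θ ∂m, ‖ws θ‖ ≤ 1 := hws.mono fun θ h => radial_bound hwb h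
    have key := stepF hUm hVm hum hwm a1 a2 a3 a4
      (fun q hq => weak2 hUm hum a1 a3 (weak1 (fun k => hUdc (σ k)) (fun k z hz => hUb _ z hz) hud hub hUl hus) hq)
      (fun q hq => weak2 hVm hwm a2 a4 (weak1 (fun k => (hVd (σ k)).diffContOnCl) (fun k z hz => hVb _ z hz) hw hwb hwl hws) hq)
      hEmeas (φ := hφm.mk φ) ?_ hφm.stronglyMeasurable_mk
    · filter_upwards [key, hφm.ae_eq_mk, ae_restrict_of_ae hws0] with θ h1 h2 h3
      rw [h1, ← h2, mul_div_cancel_left₀ _ h3]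
    · filter_upwards [hae, hφm.ae_eq_mk] with θ h1 h2
      rw [← h2]
      have h3 : Tendsto (fun k => ψ (σ k) θ - φ θ) atTop (𝓝 0) := by
        have := (h1.comp hs.tendsto_atTop).sub_const (φ θ)
        simpa [hσ, Function.comp_def] using this
      refine squeeze_zero_norm (fun k => ?_) (tendsto_zero_iff_norm_tendsto_zero.1 h3)
      have : V (σ k) (pt θ) * f (σ k) ((R (σ k) : ℂ) * pt θ) - V (σ k) (pt θ) * φ θ =
        V (σ k) (pt θ) * (ψ (σ k) θ - φ θ) := by simp only [ψ]; ring
      rw [this, norm_mul]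
      exact mul_le_of_le_one_left (norm_nonneg _) (hVb _ _ (pt_norm θ).le)

/-- **The Khintchin–Ostrowski theorem.** -/
theorem khintchin_ostrowski
    (f : ℕ → ℂ → ℂ)
    (hfan : ∀ n, DifferentiableOn ℂ (f n) (ball (0:ℂ) 1))
    -- (i) uniform bound on the integrals of `log⁺ |f_n|` over circles:
    (C : ℝ) (hC : 0 < C)
    (hbd : ∀ n, ∀ r : ℝ, 0 < r → r < 1 →
      ∫ θ, max (Real.log ‖f n ((r : ℂ) * pt θ)‖) 0 ∂m ≤ C)
    -- (ii) the radial boundary functions `f_n*` exist a.e. ...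
    (fs : ℕ → CircT → ℂ)
    (hfs : ∀ n, ∀ᵐ θ ∂m,
      Tendsto (fun r : ℝ => f n ((r : ℂ) * pt θ)) (𝓝[<] (1:ℝ)) (𝓝 (fs n θ)))
    -- ... and converge in measure on a set `E` of positive measure to `φ`:
    (E : Set CircT) (hEmeas : MeasurableSet E) (hEpos : 0 < m E)
    (φ : CircT → ℂ)
    (hconv : TendstoInMeasure (m.restrict E) fs atTop φ) :
    -- conclusion: `f_n → F` uniformly on compacts, `F` analytic, and the
    -- radial boundary values `F*` of `F` satisfy `F* = φ` a.e. on `E`: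
    ∃ F : ℂ → ℂ, DifferentiableOn ℂ F (ball (0:ℂ) 1) ∧
      TendstoLocallyUniformlyOn f F atTop (ball (0:ℂ) 1) ∧
      ∃ Fs : CircT → ℂ,
        (∀ᵐ θ ∂m,
          Tendsto (fun r : ℝ => F ((r : ℂ) * pt θ)) (𝓝[<] (1:ℝ)) (𝓝 (Fs θ))) ∧
        ∀ᵐ θ ∂(m.restrict E), Fs θ = φ θ := by
  obtain ⟨F, hF, hloc⟩ := exists_limit f hfan (fun ρ h0 h1 ε hε =>
    cauchyB f hfan C hbd fs hfs E hEmeas hEpos φ hconv h0 h1 hε)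
  exact ⟨F, hF, hloc, boundary f hfan C hbd fs hfs E hEmeas φ hconv F hF hloc⟩
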